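/- arXiv:2506.03845 — 8 statements merged into one kernel-verified Lean document; each statement's English description precedes it below -/
import Mathlib

section
/- Let 𝒜 be a complex unital Banach algebra, let n ≥ 1 be an integer, and let a, b ∈ 𝒜 both be gns-Drazin invertible, with x the gns-Drazin inverse of a; set a^π = 1 − a x. If a b a^π = 0 and (1 − a^π) b is gns-Drazin invertible, then a + b is gns-Drazin invertible if and only if a x (a + b) is gns-Drazin invertible. -/
variable {A : Type*} [NormedRing A] [NormedAlgebra ℂ A] [CompleteSpace A]

/-- An element of a complex unital Banach algebra is quasinilpotent if its spectrum is `{0}`. -/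
def IsQuasinilpotent (q : A) : Prop := spectrum ℂ q = {0}

/-- `a` is generalized `n`-strong Drazin invertible (gns-Drazin invertible): there is `x`
commuting with every element commuting with `a`, with `x * a * x = x` and
`a ^ n - a * x` quasinilpotent. -/
def IsGnsDrazinInvertible (n : ℕ) (a : A) : Prop :=
  ∃ x : A, (∀ y : A, y * a = a * y → x * y = y * x) ∧ x * a * x = x ∧
    IsQuasinilpotent (a ^ n - a * x)

/-- If `p * q = 0` then `(L - p) (L - q) = L (L - (p + q))`. -/
theorem gns_aux_mul (l : ℂ) (p q : A) (h : p * q = 0) :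
    (algebraMap ℂ A l - p) * (algebraMap ℂ A l - q) =
      algebraMap ℂ A l * (algebraMap ℂ A l - (p + q)) := by
  have hc : p * algebraMap ℂ A l = algebraMap ℂ A l * p := (Algebra.commutes l p).symm
  rw [sub_mul, mul_sub, mul_sub, h, hc]
  noncomm_ring

theorem gns_aux_unit {l : ℂ} (hl : l ≠ 0) : IsUnit (algebraMap ℂ A l) :=
  (IsUnit.mk0 l hl).map (algebraMap ℂ A)

/-- product unit iff, first factor a unit -/
theorem gns_isUnit_mul_left {u v : A} (hu : IsUnit u) : IsUnit (u * v) ↔ IsUnit v := by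
  obtain ⟨u, rfl⟩ := hu
  exact Units.isUnit_units_mul u v

theorem gns_isUnit_mul_right {u v : A} (hv : IsUnit v) : IsUnit (u * v) ↔ IsUnit u := by
  obtain ⟨v, rfl⟩ := hv
  exact Units.isUnit_mul_units u v

/-- triangular factorisation -/
theorem gns_aux_tri (l : ℂ) (e y : A) (he : e * e = e) (hy : e * y * (1 - e) = 0) :
    (algebraMap ℂ A l - e * y) * (algebraMap ℂ A l - (1 - e) * y * e) *
      (algebraMap ℂ A l - y * (1 - e)) =
      algebraMap ℂ A l * (algebraMap ℂ A l * (algebraMap ℂ A l - y)) := by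
  have hfe : (1 - e) * e = 0 := by rw [sub_mul, he, one_mul, sub_self]
  have hef : e * (1 - e) = 0 := by rw [mul_sub, he, mul_one, sub_self]
  have hey : e * y = e * y * e := by
    have := hy
    rw [mul_sub, mul_one, sub_eq_zero] at this
    exact this
  have h1 : (e * y) * ((1 - e) * y * e) = 0 := by
    rw [← mul_assoc, ← mul_assoc, hy, zero_mul, zero_mul]
  have h2 : (e * y + (1 - e) * y * e) * (y * (1 - e)) = 0 := by
    have e1 : (e * y) * (y * (1 - e)) = 0 := by
      rw [hey]
      calc e * y * e * (y * (1 - e)) = e * y * (e * y * (1 - e)) := by noncomm_ring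
        _ = 0 := by rw [hy, mul_zero]
    have e2 : ((1 - e) * y * e) * (y * (1 - e)) = 0 := by
      calc ((1 - e) * y * e) * (y * (1 - e)) = (1 - e) * y * (e * y * (1 - e)) := by noncomm_ring
        _ = 0 := by rw [hy, mul_zero]
    rw [add_mul, e1, e2, add_zero]
  rw [gns_aux_mul l _ _ h1, mul_assoc, gns_aux_mul l _ _ h2]
  congr 3
  have : e * y + (1 - e) * y * e + y * (1 - e) = y + (e * y - e * y * e) := by noncomm_ring
  rw [this, ← hey, sub_self, add_zero]

theorem gns_aux_nil_unit {l : ℂ} (hl : l ≠ 0) (N : A) (hN : N * N = 0) :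
    IsUnit (algebraMap ℂ A l - N) := by
  have h1 : N * (-N) = 0 := by rw [mul_neg, hN, neg_zero]
  have h := gns_aux_mul l N (-N) h1
  have hc : Commute (algebraMap ℂ A l - N) (algebraMap ℂ A l - (-N)) := by
    have : Commute (algebraMap ℂ A l) N := Algebra.commutes l N
    exact ((Commute.refl _).sub_left this.symm).sub_right
      ((this.sub_left (Commute.refl _)).neg_right)
  have h2 : IsUnit ((algebraMap ℂ A l - N) * (algebraMap ℂ A l - (-N))) := by
    rw [h, add_neg_cancel, sub_zero]
    exact (gns_aux_unit hl).mul (gns_aux_unit hl)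
  exact (hc.isUnit_mul_iff.mp h2).1

theorem gns_aux_tri_unit {l : ℂ} (hl : l ≠ 0) (e y : A) (he : e * e = e)
    (hy : e * y * (1 - e) = 0) (h1 : IsUnit (algebraMap ℂ A l - e * y)) :
    IsUnit (algebraMap ℂ A l - y) ↔ IsUnit (algebraMap ℂ A l - y * (1 - e)) := by
  have hN : ((1 - e) * y * e) * ((1 - e) * y * e) = 0 := by
    have hef : e * (1 - e) = 0 := by rw [mul_sub, he, mul_one, sub_self]
    calc ((1 - e) * y * e) * ((1 - e) * y * e) = (1 - e) * y * (e * (1 - e)) * y * e := by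
          noncomm_ring
      _ = 0 := by rw [hef]; noncomm_ring
  have h := gns_aux_tri l e y he hy
  have hu := (h1.mul (gns_aux_nil_unit hl _ hN))
  rw [← gns_isUnit_mul_left (gns_aux_unit (A := A) hl), ←
    gns_isUnit_mul_left (gns_aux_unit (A := A) hl), ← h, gns_isUnit_mul_left hu]

theorem gns_aux_tri_unit' {l : ℂ} (hl : l ≠ 0) (e y : A) (he : e * e = e)
    (hy : e * y * (1 - e) = 0) (h1 : IsUnit (algebraMap ℂ A l - y * (1 - e))) :
    IsUnit (algebraMap ℂ A l - y) ↔ IsUnit (algebraMap ℂ A l - e * y) := by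
  have hN : ((1 - e) * y * e) * ((1 - e) * y * e) = 0 := by
    have hef : e * (1 - e) = 0 := by rw [mul_sub, he, mul_one, sub_self]
    calc ((1 - e) * y * e) * ((1 - e) * y * e) = (1 - e) * y * (e * (1 - e)) * y * e := by
          noncomm_ring
      _ = 0 := by rw [hef]; noncomm_ring
  have h := gns_aux_tri l e y he hy
  rw [← gns_isUnit_mul_left (gns_aux_unit (A := A) hl), ←
    gns_isUnit_mul_left (gns_aux_unit (A := A) hl), ← h, gns_isUnit_mul_right h1,
    gns_isUnit_mul_right (gns_aux_nil_unit hl _ hN)]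

theorem qn_unit {q : A} (hq : IsQuasinilpotent q) {l : ℂ} (hl : l ≠ 0) :
    IsUnit (algebraMap ℂ A l - q) := by
  have : l ∉ spectrum ℂ q := by rw [hq]; simpa using hl
  exact spectrum.notMem_iff.mp this

theorem qn_of_unit [Nontrivial A] {q : A}
    (h : ∀ l : ℂ, l ≠ 0 → IsUnit (algebraMap ℂ A l - q)) : IsQuasinilpotent q := by
  refine (Set.Nonempty.subset_singleton_iff (spectrum.nonempty q)).mp ?_
  intro l hl
  by_contra hne
  exact spectrum.notMem_iff.mpr (h l hne) hl

/-- A power of the scalar being in the resolvent of the power. -/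
theorem unit_of_pow {l : ℂ} (n : ℕ) (a : A) (h : IsUnit (algebraMap ℂ A (l ^ n) - a ^ n)) :
    IsUnit (algebraMap ℂ A l - a) := by
  by_contra hne
  have h1 : l ∈ spectrum ℂ a := spectrum.mem_iff.mpr hne
  have h2 := spectrum.pow_image_subset a n ⟨l, h1, rfl⟩
  exact spectrum.mem_iff.mp h2 h

/-- forward characterization -/
theorem gns_unit {n : ℕ} {a : A} (h : IsGnsDrazinInvertible n a) {l : ℂ} (hl : l ≠ 0)
    (hln : l ^ n ≠ 1) : IsUnit (algebraMap ℂ A l - a) := by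
  obtain ⟨x, hc, hxax, hq⟩ := h
  have hxa : x * a = a * x := hc a rfl
  apply unit_of_pow n
  set e := a * x with hedef
  have he : e * e = e := by
    rw [hedef, ← mul_assoc, mul_assoc a x a, mul_assoc a (x * a) x, hxax]
  set q := a ^ n - e with hqdef
  have hae : Commute a e := by
    rw [hedef]; exact (Commute.refl a).mul_right hxa.symm
  have hqe : Commute q e := (hae.pow_left n).sub_left (Commute.refl e)
  have hm : l ^ n ≠ 0 := pow_ne_zero _ hl
  set m := l ^ n
  set t := algebraMap ℂ A m - q with ht
  have hte : t * e = e * t :=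
    (Commute.sub_left (Algebra.commutes m e : Commute (algebraMap ℂ A m) e) hqe)
  have hu1 : IsUnit t := qn_unit hq hm
  have hu2 : IsUnit (t - 1) := by
    have := qn_unit hq (sub_ne_zero.mpr hln)
    rw [map_sub, map_one] at this
    convert this using 1
    rw [ht]; abel
  have hid : (t - e) * (t - 1 + e) = t * (t - 1) := by
    calc (t - e) * (t - 1 + e) = t * (t - 1) + (t * e - e * t) + (e - e * e) := by noncomm_ring
      _ = _ := by rw [hte, he]; simp
  have hid2 : (t - 1 + e) * (t - e) = t * (t - 1) := by
    calc (t - 1 + e) * (t - e) = t * (t - 1) - (t * e - e * t) + (e - e * e) := by noncomm_ring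
      _ = _ := by rw [hte, he]; simp
  have hcm : Commute (t - e) (t - 1 + e) := hid.trans hid2.symm
  have : IsUnit (t - e) := (hcm.isUnit_mul_iff.mp (hid ▸ hu1.mul hu2)).1
  convert this using 1
  rw [ht, hqdef]; abel

/-- the part `a (1 - a x)` has no nonzero spectrum -/
theorem gns_res_unit {n : ℕ} {a x : A} (hn : 1 ≤ n) (hxa : x * a = a * x) (hxax : x * a * x = x)
    (hq : IsQuasinilpotent (a ^ n - a * x)) {l : ℂ} (hl : l ≠ 0) :
    IsUnit (algebraMap ℂ A l - a * (1 - a * x)) := by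
  apply unit_of_pow n
  set e := a * x with hedef
  have he : e * e = e := by
    rw [hedef, ← mul_assoc, mul_assoc a x a, mul_assoc a (x * a) x, hxax]
  set q := a ^ n - e with hqdef
  have hae : Commute a e := by
    rw [hedef]; exact (Commute.refl a).mul_right hxa.symm
  have hqe : Commute q e := (hae.pow_left n).sub_left (Commute.refl e)
  have hef : e * (1 - e) = 0 := by rw [mul_sub, he, mul_one, sub_self]
  have hfe : (1 - e) * e = 0 := by rw [sub_mul, he, one_mul, sub_self]
  have hidf : IsIdempotentElem (1 - e) := IsIdempotentElem.one_sub he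
  have hpow : (a * (1 - e)) ^ n = q * (1 - e) := by
    have : Commute a (1 - e) := (Commute.one_right a).sub_right hae
    rw [this.mul_pow, hidf.pow_eq (by omega), hqdef, sub_mul, hef, sub_zero]
  rw [hpow]
  have hm : l ^ n ≠ 0 := pow_ne_zero _ hl
  have hqf : Commute q (1 - e) := (Commute.one_right q).sub_right hqe
  have h1 : (q * (1 - e)) * (q * e) = 0 := by
    rw [hqf.eq, mul_assoc, ← mul_assoc q q e, ((hqe.mul_left hqe)).eq, ← mul_assoc, hfe, zero_mul]
  have h2 : (q * e) * (q * (1 - e)) = 0 := by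
    rw [hqe.eq, mul_assoc, ← mul_assoc q q, ((hqf.mul_left hqf)).eq, ← mul_assoc, hef, zero_mul]
  have k1 := gns_aux_mul (l ^ n) _ _ h1
  have k2 := gns_aux_mul (l ^ n) _ _ h2
  have hcm : Commute (algebraMap ℂ A (l ^ n) - q * (1 - e)) (algebraMap ℂ A (l ^ n) - q * e) := by
    rw [add_comm] at k2
    exact k1.trans k2.symm
  refine (hcm.isUnit_mul_iff.mp ?_).1
  rw [k1]
  have : q * (1 - e) + q * e = q := by noncomm_ring
  rw [this]
  exact (gns_aux_unit hm).mul (qn_unit hq hm)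

/-- norms of powers of a quasinilpotent decay faster than geometric -/
theorem qn_norm_pow {q : A} (hq : IsQuasinilpotent q) {ε : ℝ} (hε : 0 < ε) :
    ∀ᶠ k : ℕ in Filter.atTop, ‖q ^ k‖ ≤ ε ^ k := by
  have hr : spectralRadius ℂ q = 0 := by
    unfold spectralRadius
    rw [hq]; simp
  have h := spectrum.pow_norm_pow_one_div_tendsto_nhds_spectralRadius q
  rw [hr] at h
  have h2 := h.eventually (gt_mem_nhds (ENNReal.ofReal_pos.mpr hε))
  filter_upwards [h2, Filter.eventually_gt_atTop 0] with k hk hk0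
  have h3 : ‖q ^ k‖ ^ (1 / k : ℝ) < ε := (ENNReal.ofReal_lt_ofReal_iff hε).mp hk
  have h4 : (‖q ^ k‖ ^ (1 / k : ℝ)) ^ k ≤ ε ^ k :=
    pow_le_pow_left₀ (by positivity) h3.le k
  rwa [one_div, Real.rpow_inv_natCast_pow (norm_nonneg _) (by omega)] at h4

theorem qn_one_sub {q v : A} (hq : IsQuasinilpotent q) (hv : Commute v q) :
    IsUnit (1 - v * q) := by
  have hε : 0 < 1 / (2 * (‖v‖ + 1)) := by positivity
  obtain ⟨k, hk, hk0⟩ := ((qn_norm_pow hq hε).and (Filter.eventually_gt_atTop 0)).exists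
  have h1 : ‖(v * q) ^ k‖ < 1 := by
    rw [hv.mul_pow]
    calc ‖v ^ k * q ^ k‖ ≤ ‖v‖ ^ k * (1 / (2 * (‖v‖ + 1))) ^ k := by
          refine (norm_mul_le _ _).trans ?_
          gcongr
          exact norm_pow_le' v hk0
      _ = (‖v‖ * (1 / (2 * (‖v‖ + 1)))) ^ k := (mul_pow _ _ _).symm
      _ < 1 := by
          apply pow_lt_one₀ (by positivity) _ (by omega)
          rw [mul_one_div, div_lt_one (by positivity)]
          linarith [norm_nonneg v]
  have h2 : IsUnit (1 - (v * q) ^ k) := isUnit_one_sub_of_norm_lt_one h1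
  have h3 := mul_neg_geom_sum (v * q) k
  have h4 := geom_sum_mul_neg (v * q) k
  have hc : Commute (1 - v * q) (∑ i ∈ Finset.range k, (v * q) ^ i) := h3.trans h4.symm
  exact (hc.isUnit_mul_iff.mp (h3 ▸ h2)).1

theorem qn_mul [Nontrivial A] {q v : A} (hq : IsQuasinilpotent q) (hv : Commute v q) :
    IsQuasinilpotent (v * q) := by
  apply qn_of_unit
  intro l hl
  have hc : Commute (algebraMap ℂ A l⁻¹ * v) q :=
    Commute.mul_left (Algebra.commutes _ _) hv
  have h := qn_one_sub hq hc
  have h2 : algebraMap ℂ A l - v * q = algebraMap ℂ A l * (1 - algebraMap ℂ A l⁻¹ * v * q) := by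
    rw [mul_sub, mul_one, ← mul_assoc, ← mul_assoc, ← map_mul, mul_inv_cancel₀ hl, map_one,
      one_mul]
  rw [h2]
  exact (gns_aux_unit hl).mul h

/-- Catalan series. -/
theorem qn_catalan {r : A} (hr : IsQuasinilpotent r) :
    ∃ c : A, c = 1 + r * (c * c) ∧ ∀ y, Commute y r → Commute y c := by
  have hbound : ∀ k, (catalan k : ℝ) ≤ 4 ^ k := by
    intro k
    have h1 : catalan k ≤ k.centralBinom := by
      rw [← succ_mul_catalan_eq_centralBinom]
      nlinarith [Nat.zero_le (catalan k), Nat.zero_le (k * catalan k)]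
    exact_mod_cast h1.trans (Nat.centralBinom_le_four_pow k)
  have hs : Summable (fun k => ‖(catalan k : A) * r ^ k‖) := by
    refine Summable.of_norm_bounded_eventually_nat (g := fun k => (1 / 2 : ℝ) ^ k)
      (summable_geometric_of_lt_one (by norm_num) (by norm_num)) ?_
    filter_upwards [qn_norm_pow hr (show (0 : ℝ) < 1 / 8 by norm_num)] with k hk
    rw [norm_norm, ← nsmul_eq_mul]
    calc ‖catalan k • r ^ k‖ ≤ catalan k * ‖r ^ k‖ := norm_nsmul_le
      _ ≤ 4 ^ k * (1 / 8) ^ k := by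
          gcongr
          exact hbound k
      _ = (1 / 2 : ℝ) ^ k := by rw [← mul_pow]; norm_num
  refine ⟨∑' k, (catalan k : A) * r ^ k, ?_, ?_⟩
  · rw [tsum_mul_tsum_eq_tsum_sum_antidiagonal_of_summable_norm hs hs]
    have hs' := (summable_norm_sum_mul_antidiagonal_of_summable_norm hs hs).of_norm
    rw [hs.of_norm.tsum_eq_zero_add, ← hs'.tsum_mul_left]
    simp only [catalan_zero, Nat.cast_one, pow_zero, mul_one]
    congr 1
    apply tsum_congr
    intro k
    rw [catalan_succ', Nat.cast_sum, Finset.sum_mul, Finset.mul_sum]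
    apply Finset.sum_congr rfl
    intro ij hij
    rw [Finset.HasAntidiagonal.mem_antidiagonal] at hij
    rw [← hij, Nat.cast_mul]
    have c1 : Commute r (catalan ij.1 : A) := (Nat.commute_cast r _)
    have c2 : Commute (r ^ ij.1) (catalan ij.2 : A) := (Nat.commute_cast _ _)
    rw [pow_succ', pow_add]
    calc (catalan ij.1 : A) * catalan ij.2 * (r * (r ^ ij.1 * r ^ ij.2))
        = (catalan ij.1 : A) * (catalan ij.2 * r) * (r ^ ij.1 * r ^ ij.2) := by noncomm_ring
      _ = (catalan ij.1 : A) * r * (catalan ij.2 * r ^ ij.1) * r ^ ij.2 := by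
          rw [← (Nat.commute_cast r (catalan ij.2)).eq]; noncomm_ring
      _ = _ := by rw [← c1.eq, ← c2.eq]; noncomm_ring
  · intro y hy
    exact Commute.tsum_right _ fun k => (Nat.commute_cast y _).mul_right (hy.pow_right k)

/-- idempotent lifting -/
theorem idem_lift [Nontrivial A] {p : A} (hr : IsQuasinilpotent (p - p * p)) :
    ∃ e : A, e * e = e ∧ (∀ y, Commute y p → Commute y e) ∧ IsQuasinilpotent (p - e) := by
  obtain ⟨c, hc, hcc⟩ := qn_catalan hr
  set r := p - p * p with hrdef
  have hyr : ∀ y, Commute y p → Commute y r := fun y hy => hy.sub_right (hy.mul_right hy)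
  have hyc : ∀ y, Commute y p → Commute y c := fun y hy => hcc y (hyr y hy)
  have hpr : Commute p r := hyr p (Commute.refl p)
  have hpc : Commute p c := hyc p (Commute.refl p)
  have hrc : Commute r c := hcc r (Commute.refl r)
  -- s = 1 - 2 r c
  obtain ⟨s, hs⟩ : ∃ s, s = 1 - 2 * (r * c) := ⟨_, rfl⟩
  have hss : s * s = 1 - 4 * r := by
    have h1 : r * c = r + r * (r * (c * c)) := by
      conv_lhs => rw [hc]
      noncomm_ring
    have h2 : (r * c) * (r * c) = r * (r * (c * c)) := by
      calc (r * c) * (r * c) = r * (c * r) * c := by noncomm_ring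
        _ = _ := by rw [← hrc.eq]; noncomm_ring
    calc s * s = 1 - 4 * (r * c) + 4 * ((r * c) * (r * c)) := by rw [hs]; noncomm_ring
      _ = 1 - 4 * r := by rw [h2]; rw [h1]; noncomm_ring
  have hcomm4 : ∀ y, Commute y p → Commute y s := by
    intro y hy
    rw [hs]
    exact (Commute.one_right y).sub_right
      ((Commute.ofNat_right y 2).mul_right ((hyr y hy).mul_right (hyc y hy)))
  have hsu : IsUnit s := by
    have h1 : IsUnit (1 - 4 * r) := qn_one_sub hr (Commute.ofNat_left 4 r)
    rw [← hss] at h1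
    exact ((Commute.refl s).isUnit_mul_iff.mp h1).1
  obtain ⟨s, rfl⟩ := hsu
  have hyi : ∀ y, Commute y p → Commute y (↑s⁻¹ : A) := fun y hy => (hcomm4 y hy).units_inv_right
  have hw : (2 * p - 1) * (2 * p - 1) = (s : A) * s := by
    rw [hss, hrdef]; noncomm_ring
  obtain ⟨j, hj⟩ : ∃ j, j = (2 * p - 1) * (↑s⁻¹ : A) := ⟨_, rfl⟩
  have hws : Commute (2 * p - 1) (↑s⁻¹ : A) :=
    ((Commute.ofNat_left 2 _).mul_left (hyi p (Commute.refl p))).sub_left (Commute.one_left _)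
  have hjj : j * j = 1 := by
    calc j * j = (2 * p - 1) * ((↑s⁻¹ : A) * (2 * p - 1)) * (↑s⁻¹ : A) := by rw [hj]; noncomm_ring
      _ = ((2 * p - 1) * (2 * p - 1)) * (↑s⁻¹ : A) * (↑s⁻¹ : A) := by
          rw [← hws.eq]; noncomm_ring
      _ = 1 := by rw [hw]; simp [mul_assoc]
  have hyj : ∀ y, Commute y p → Commute y j := by
    intro y hy
    rw [hj]
    exact (((Commute.ofNat_right y 2).mul_right hy).sub_right (Commute.one_right y)).mul_right
      (hyi y hy)
  have hjs : j * s = 2 * p - 1 := by rw [hj]; simp [mul_assoc]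
  obtain ⟨H, hH⟩ : ∃ H : A, H = algebraMap ℂ A (1 / 2) := ⟨_, rfl⟩
  have hHc : ∀ y, Commute y H := fun y => by rw [hH]; exact (Algebra.commutes _ _).symm
  have hH2 : H * 2 = 1 := by
    rw [hH, show (2 : A) = algebraMap ℂ A 2 from (map_ofNat (algebraMap ℂ A) 2).symm, ← map_mul]; norm_num
  refine ⟨H * (1 + j), ?_, ?_, ?_⟩
  · calc H * (1 + j) * (H * (1 + j)) = H * ((1 + j) * H) * (1 + j) := by noncomm_ring
      _ = H * H * (1 + 2 * j + j * j) := by rw [(hHc (1 + j)).eq]; noncomm_ring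
      _ = H * (H * 2) * (1 + j) := by rw [hjj]; noncomm_ring
      _ = _ := by rw [hH2, mul_one]
  · intro y hy
    exact (hHc y).mul_right ((Commute.one_right y).add_right (hyj y hy))
  · have hd : p - H * (1 + j) = (-(j * c)) * r := by
      have h1 : 2 * p - 1 - j = -2 * (j * (c * r)) := by
        rw [← hjs, hs, hrc.eq]; noncomm_ring
      calc p - H * (1 + j) = (H * 2) * p - H * (1 + j) := by rw [hH2, one_mul]
        _ = H * (2 * p - 1 - j) := by noncomm_ring
        _ = -((H * 2) * (j * (c * r))) := by rw [h1]; noncomm_ring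
        _ = _ := by rw [hH2]; noncomm_ring
    rw [hd]
    apply qn_mul hr
    exact ((hyr j (hyj p (Commute.refl p)).symm).mul_left hrc.symm).neg_left

/-- converse characterization -/
theorem gns_of_unit [Nontrivial A] {n : ℕ} (hn : 1 ≤ n) {a : A}
    (h : ∀ l : ℂ, l ≠ 0 → l ^ n ≠ 1 → IsUnit (algebraMap ℂ A l - a)) :
    IsGnsDrazinInvertible n a := by
  have hr : IsQuasinilpotent (a ^ n - a ^ n * a ^ n) := by
    refine (Set.Nonempty.subset_singleton_iff (spectrum.nonempty _)).mp ?_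
    have hm := spectrum.map_polynomial_aeval a
      ((Polynomial.X : Polynomial ℂ) ^ n - Polynomial.X ^ n * Polynomial.X ^ n)
    simp only [map_sub, map_mul, map_pow, Polynomial.aeval_X] at hm
    rw [hm]
    rintro _ ⟨l, hl, rfl⟩
    simp only [Polynomial.eval_sub, Polynomial.eval_mul, Polynomial.eval_pow, Polynomial.eval_X,
      Set.mem_singleton_iff]
    by_cases h0 : l = 0
    · subst h0
      rw [zero_pow (by omega)]; simp
    · by_cases h1 : l ^ n = 1
      · rw [h1]; simp
      · exact absurd (h l h0 h1) (spectrum.mem_iff.mp hl)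
  obtain ⟨e, he, hec, hq⟩ := idem_lift hr
  have hya : ∀ y, Commute y a → Commute y e := fun y hy => hec y (hy.pow_right n)
  have hae : Commute a e := hya a (Commute.refl a)
  have hee : Commute e (a ^ n - e) := (hae.pow_left n).symm.sub_right (Commute.refl e)
  have hu : IsUnit (1 - (-e) * (a ^ n - e)) := qn_one_sub hq hee.neg_left
  obtain ⟨u, hu⟩ := hu
  have hyu : ∀ y, Commute y a → Commute y (u : A) := by
    intro y hy
    rw [hu]
    exact (Commute.one_right y).sub_right
      ((hya y hy).neg_right.mul_right ((hy.pow_right n).sub_right (hya y hy)))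
  have hyi : ∀ y, Commute y a → Commute y (↑u⁻¹ : A) := fun y hy => (hyu y hy).units_inv_right
  have hue : e * a ^ n = e * u := by
    rw [hu]
    calc e * a ^ n = e * e + (e * e) * a ^ n - (e * e) * e + (e * a ^ n - e * e * a ^ n)
          + (e * e * e - e * e) := by noncomm_ring
      _ = e + (e * e) * a ^ n - (e * e) * e := by simp only [he]; abel
      _ = _ := by noncomm_ring
  have hax : a * (e * a ^ (n - 1) * (↑u⁻¹ : A)) = e := by
    calc a * (e * a ^ (n - 1) * (↑u⁻¹ : A)) = (a * e) * a ^ (n - 1) * (↑u⁻¹ : A) := by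
          noncomm_ring
      _ = e * (a * a ^ (n - 1)) * (↑u⁻¹ : A) := by rw [hae.eq]; noncomm_ring
      _ = e * a ^ n * (↑u⁻¹ : A) := by rw [← pow_succ', Nat.sub_add_cancel hn]
      _ = e := by rw [hue, mul_assoc, Units.mul_inv, mul_one]
  have hxc : ∀ y, Commute y a → Commute y (e * a ^ (n - 1) * (↑u⁻¹ : A)) := fun y hy =>
    ((hya y hy).mul_right (hy.pow_right _)).mul_right (hyi y hy)
  refine ⟨e * a ^ (n - 1) * (↑u⁻¹ : A), fun y hy => (hxc y hy).symm, ?_, ?_⟩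
  · rw [mul_assoc _ a, hax, ← (hxc e hae.symm).eq, ← mul_assoc, ← mul_assoc, he]
  · rw [hax]; exact hq

theorem isGnsDrazinInvertible_add_iff (n : ℕ) (hn : 1 ≤ n) (a b x : A)
    (hx : (∀ z : A, z * a = a * z → x * z = z * x) ∧ x * a * x = x ∧
      IsQuasinilpotent (a ^ n - a * x))
    (hb : IsGnsDrazinInvertible n b)
    (h1 : a * b * (1 - a * x) = 0)
    (h2 : IsGnsDrazinInvertible n ((1 - (1 - a * x)) * b)) :
    IsGnsDrazinInvertible n (a + b) ↔ IsGnsDrazinInvertible n (a * x * (a + b)) := by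
  obtain ⟨hc, hxax, hq⟩ := hx
  have hnt : Nontrivial A := by
    by_contra hne
    rw [not_nontrivial_iff_subsingleton] at hne
    have h0 : (0 : ℂ) ∈ spectrum ℂ (a ^ n - a * x) := by rw [hq]; rfl
    exact spectrum.mem_iff.mp h0 (isUnit_of_subsingleton _)
  have hxa : x * a = a * x := hc a rfl
  have hres := fun (l : ℂ) (hl : l ≠ 0) => gns_res_unit hn hxa hxax hq hl
  rw [sub_sub_cancel] at h2
  have he : (a * x) * (a * x) = a * x := by
    rw [← mul_assoc, mul_assoc a x a, mul_assoc a (x * a) x, hxax]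
  have hae : Commute a (a * x) := (Commute.refl a).mul_right hxa.symm
  have heb : a * x * b * (1 - a * x) = 0 := by
    rw [← hxa, mul_assoc x a b, mul_assoc x, hxa, h1, mul_zero]
  generalize a * x = e at *
  have hef : e * (1 - e) = 0 := by rw [mul_sub, he, mul_one, sub_self]
  have hea : e * a * (1 - e) = 0 := by rw [← hae.eq, mul_assoc, hef, mul_zero]
  have hes : e * (a + b) * (1 - e) = 0 := by rw [mul_add, add_mul, hea, heb, add_zero]
  have hprod : (a * (1 - e)) * (b * (1 - e)) = 0 := by
    calc (a * (1 - e)) * (b * (1 - e)) = a * b * (1 - e) - a * (e * b * (1 - e)) := by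
          noncomm_ring
      _ = 0 := by rw [h1, heb]; simp
  have key : ∀ l : ℂ, l ≠ 0 → l ^ n ≠ 1 →
      (IsUnit (algebraMap ℂ A l - (a + b)) ↔ IsUnit (algebraMap ℂ A l - e * (a + b))) := by
    intro l hl hln
    apply gns_aux_tri_unit' hl e _ he hes
    have hbu := (gns_aux_tri_unit hl e b he heb (gns_unit h2 hl hln)).mp (gns_unit hb hl hln)
    have := (hres l hl).mul hbu
    rw [gns_aux_mul l _ _ hprod, gns_isUnit_mul_left (gns_aux_unit hl), ← add_mul] at this
    exact this
  constructor
  · intro h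
    exact gns_of_unit hn fun l hl hln => (key l hl hln).mp (gns_unit h hl hln)
  · intro h
    exact gns_of_unit hn fun l hl hln => (key l hl hln).mpr (gns_unit h hl hln)
end

section
/- Let 𝒜 be a complex unital Banach algebra and let a, b ∈ 𝒜 both be quasinilpotent. If a b² = b a b and a² b = a b a, then a + b is quasinilpotent. -/
variable {A : Type*} [NormedRing A] [NormedAlgebra ℂ A] [CompleteSpace A]

theorem spectralRadius_mul_aux (x y z : A) (h : ∀ n : ℕ, z ^ n = x ^ n * y ^ n)
    (hx : spectralRadius ℂ x ≠ ⊤) (hy : spectralRadius ℂ y ≠ ⊤) :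
    spectralRadius ℂ z ≤ spectralRadius ℂ x * spectralRadius ℂ y := by
  have tx := spectrum.pow_nnnorm_pow_one_div_tendsto_nhds_spectralRadius x
  have ty := spectrum.pow_nnnorm_pow_one_div_tendsto_nhds_spectralRadius y
  have tz := spectrum.pow_nnnorm_pow_one_div_tendsto_nhds_spectralRadius z
  refine le_of_tendsto_of_tendsto' tz (ENNReal.Tendsto.mul tx (Or.inr hy) ty (Or.inr hx)) ?_
  intro n
  rw [← ENNReal.mul_rpow_of_nonneg _ _ (by positivity), h n]
  refine ENNReal.rpow_le_rpow ?_ (by positivity)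
  exact_mod_cast nnnorm_mul_le _ _

theorem spectralRadius_ne_top_aux (x : A) : spectralRadius ℂ x ≠ ⊤ := by
  have h := spectrum.spectralRadius_le_pow_nnnorm_pow_one_div ℂ x 0
  refine ne_top_of_le_ne_top ?_ h
  refine ENNReal.mul_ne_top ?_ ?_ <;> simp

theorem isUnit_aux (q : A) (h : IsQuasinilpotent q) (z : ℂ) (hz : z ≠ 0) :
    IsUnit (algebraMap ℂ A z - q) := by
  by_contra hn
  have : z ∈ spectrum ℂ q := hn
  rw [h] at this
  exact hz this

theorem quasinilpotent_add (a b : A)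
    (ha : IsQuasinilpotent a) (hb : IsQuasinilpotent b)
    (h1 : a * b ^ 2 = b * a * b) (h2 : a ^ 2 * b = a * b * a) :
    IsQuasinilpotent (a + b) := by
  have hnt : Nontrivial A := by
    by_contra hn
    rw [not_nontrivial_iff_subsingleton] at hn
    have h0 : (0 : ℂ) ∈ spectrum ℂ a := by rw [ha]; rfl
    exact h0 (isUnit_of_subsingleton _)
  have ca : Commute (a * b) a := by
    show a * b * a = a * (a * b)
    rw [← h2, pow_two, mul_assoc]
  have cb : Commute (a * b) b := by
    show a * b * b = b * (a * b)
    rw [← mul_assoc b, ← h1, pow_two, mul_assoc]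
  have hp : ∀ n : ℕ, (a * b) ^ n = a ^ n * b ^ n := by
    intro n
    induction n with
    | zero => simp
    | succ k ih =>
      rw [pow_succ', pow_succ a, pow_succ' b, ih, ← mul_assoc, (ca.pow_right k).eq]
      simp only [mul_assoc]
  have ra : spectralRadius ℂ a = 0 := by
    have : spectrum ℂ a = {0} := ha
    simp [spectralRadius, this]
  have rp : spectralRadius ℂ (a * b) = 0 := by
    have := spectralRadius_mul_aux a b (a * b) hp (spectralRadius_ne_top_aux a)
      (spectralRadius_ne_top_aux b)
    rw [ra, zero_mul] at this
    exact le_antisymm this bot_le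
  have key : ∀ z ∈ spectrum ℂ (a + b), z = 0 := by
    intro z hz
    by_contra hz0
    apply hz
    obtain ⟨u, hu⟩ := (isUnit_aux a ha z hz0).mul (isUnit_aux b hb z hz0)
    have cu : Commute (a * b) (u : A) := by
      rw [hu]
      exact ((Algebra.commute_algebraMap_right z _).sub_right ca).mul_right
        ((Algebra.commute_algebraMap_right z _).sub_right cb)
    have cui : Commute (a * b) ((u⁻¹ : Aˣ) : A) := cu.units_inv_right
    have rq : spectralRadius ℂ (a * b * ((u⁻¹ : Aˣ) : A)) = 0 := by
      have := spectralRadius_mul_aux (a * b) ((u⁻¹ : Aˣ) : A) _ (fun n => cui.mul_pow n)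
        (spectralRadius_ne_top_aux _) (spectralRadius_ne_top_aux _)
      rw [rp, zero_mul] at this
      exact le_antisymm this bot_le
    have hq : IsUnit (1 - a * b * ((u⁻¹ : Aˣ) : A)) := by
      have : (1 : ℂ) ∈ resolventSet ℂ (a * b * ((u⁻¹ : Aˣ) : A)) :=
        spectrum.mem_resolventSet_of_spectralRadius_lt (by rw [rq]; simp)
      simpa [resolventSet] using this
    have e : z • (algebraMap ℂ A z - (a + b)) = (1 - a * b * ((u⁻¹ : Aˣ) : A)) * u := by
      rw [sub_mul, mul_assoc (a * b), Units.inv_mul, mul_one, one_mul, hu]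
      simp only [Algebra.algebraMap_eq_smul_one, sub_mul, mul_sub, smul_sub, smul_add,
        smul_mul_assoc, mul_smul_comm, one_mul, mul_one]
      abel
    have hu2 : IsUnit (z • (algebraMap ℂ A z - (a + b))) := by
      rw [e]; exact hq.mul u.isUnit
    exact (isUnit_smul_iff (Units.mk0 z hz0) (algebraMap ℂ A z - (a + b))).1 hu2
  obtain ⟨w, hw⟩ := spectrum.nonempty (a + b)
  ext z
  constructor
  · intro hz; exact key z hz
  · intro hz
    rw [Set.mem_singleton_iff] at hz
    rw [hz, ← key w hw]; exact hw
end

section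
/- Let 𝒜 be a complex unital Banach algebra, let n ≥ 1 be an integer, and let a, b ∈ 𝒜 both be gns-Drazin invertible with gns-Drazin inverses x and y respectively. Assume a² b = a b a, a b² = b a b, and a x b is gns-Drazin invertible. Then the following are equivalent: (1) a + b is gns-Drazin invertible; (2) a x (a + b) b y is gns-Drazin invertible; (3) a x (a + b) is gns-Drazin invertible; (4) (a + b) b y is gns-Drazin invertible. -/
variable {A : Type*} [NormedRing A] [NormedAlgebra ℂ A] [CompleteSpace A]

set_option linter.unusedSectionVars false

/-- Growth form of quasinilpotency. -/
def GQn (q : A) : Prop := ∀ ε : ℝ, 0 < ε → ∃ C : ℝ, 0 < C ∧ ∀ k : ℕ, ‖q ^ (k + 1)‖ ≤ C * ε ^ (k + 1)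

theorem GQn.of_spectrum {q : A} (h : spectrum ℂ q ⊆ {0}) : GQn q := by
  intro ε hε
  have hr : spectralRadius ℂ q = 0 := by
    unfold spectralRadius
    simp only [ENNReal.iSup_eq_zero]
    intro z hz
    have : z = 0 := h hz
    simp [this]
  have ht := spectrum.pow_nnnorm_pow_one_div_tendsto_nhds_spectralRadius q
  rw [hr] at ht
  have hε' : (0 : ENNReal) < ENNReal.ofReal ε := by simpa using hε
  have hev := ht.eventually (gt_mem_nhds hε')
  have hev2 : ∀ᶠ k : ℕ in Filter.atTop, ‖q ^ k‖ / ε ^ k ≤ 1 := by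
    filter_upwards [hev, Filter.eventually_ge_atTop 1] with k hk hk1
    rw [div_le_one (by positivity)]
    have hk0 : (k : ℝ) ≠ 0 := by
      have : k ≠ 0 := by omega
      exact_mod_cast this
    have h2 : (‖q ^ k‖₊ : ENNReal) ≤ ENNReal.ofReal ε ^ k := by
      have := pow_le_pow_left' hk.le k
      rwa [← ENNReal.rpow_natCast, ← ENNReal.rpow_mul, one_div, inv_mul_cancel₀ hk0,
        ENNReal.rpow_one] at this
    rw [← ENNReal.ofReal_pow hε.le] at h2
    have h3 : ENNReal.ofReal ‖q ^ k‖ ≤ ENNReal.ofReal (ε ^ k) := by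
      rwa [ofReal_norm]
    exact (ENNReal.ofReal_le_ofReal_iff (by positivity)).1 h3
  have hb : BddAbove (Set.range fun k : ℕ => ‖q ^ k‖ / ε ^ k) :=
    Filter.IsBoundedUnder.bddAbove_range ⟨1, by simpa using hev2⟩
  obtain ⟨C, hC⟩ := hb
  refine ⟨max C 1, by positivity, fun k => ?_⟩
  have h1 : ‖q ^ (k + 1)‖ / ε ^ (k + 1) ≤ C := hC ⟨k + 1, rfl⟩
  rw [div_le_iff₀ (by positivity)] at h1
  exact h1.trans (mul_le_mul_of_nonneg_right (le_max_left _ _) (by positivity))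

theorem GQn.of_bound {q r : A} (M : ℝ) (D : ℝ) (hq : GQn q) (hM : 0 < M) (hD : 0 < D)
    (h : ∀ k : ℕ, ‖r ^ (k + 1)‖ ≤ D * M ^ (k + 1) * ‖q ^ (k + 1)‖) : GQn r := by
  intro ε hε
  obtain ⟨C, hC, hb⟩ := hq (ε / M) (by positivity)
  refine ⟨D * C, by positivity, fun k => (h k).trans ?_⟩
  calc D * M ^ (k + 1) * ‖q ^ (k + 1)‖ ≤ D * M ^ (k + 1) * (C * (ε / M) ^ (k + 1)) := by
        gcongr; exact hb k
    _ = D * C * ε ^ (k + 1) := by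
        rw [div_pow]; field_simp

theorem norm_pow_succ_bd (w : A) (k : ℕ) : ‖w ^ (k + 1)‖ ≤ (‖w‖ + 1) ^ (k + 1) :=
  (norm_pow_le' w (Nat.succ_pos k)).trans (by gcongr; linarith)

theorem GQn.mul {q w : A} (hq : GQn q) (h : Commute q w) : GQn (q * w) := by
  refine GQn.of_bound (‖w‖ + 1) 1 hq (by positivity) one_pos fun k => ?_
  rw [h.mul_pow, one_mul, mul_comm]
  exact (norm_mul_le _ _).trans (by gcongr; exact norm_pow_succ_bd w k)

theorem GQn.mul' {q w : A} (hq : GQn q) (h : Commute q w) : GQn (w * q) := by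
  rw [← h.eq]; exact hq.mul h

theorem GQn.isUnit_one_sub {q : A} (hq : GQn q) : IsUnit (1 - q) := by
  obtain ⟨C, hC, hb⟩ := hq (1 / 2) (by norm_num)
  have ht : Filter.Tendsto (fun k : ℕ => C * (1 / 2 : ℝ) ^ (k + 1)) Filter.atTop (nhds (C * 0)) :=
    ((tendsto_pow_atTop_nhds_zero_of_lt_one (by norm_num) (by norm_num)).comp
      (Filter.tendsto_add_atTop_nat 1)).const_mul C
  rw [mul_zero] at ht
  obtain ⟨k, hk⟩ := (ht.eventually (gt_mem_nhds one_pos)).exists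
  have hu : IsUnit (1 - q ^ (k + 1)) := isUnit_one_sub_of_norm_lt_one ((hb k).trans_lt hk)
  rw [← mul_neg_geom_sum] at hu
  refine (Commute.isUnit_mul_iff ?_).1 hu |>.1
  show _ = _
  rw [mul_neg_geom_sum, geom_sum_mul_neg]

theorem GQn.isUnit_sub {u q : A} (hq : GQn q) (hu : IsUnit u) (h : Commute u q) :
    IsUnit (u - q) := by
  obtain ⟨v, rfl⟩ := hu
  have h1 : Commute q (↑v⁻¹ : A) := h.symm.units_inv_right
  have : (v : A) - q = v * (1 - q * ↑v⁻¹) := by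
    rw [h1.eq, mul_sub, mul_one, Units.mul_inv_cancel_left]
  rw [this]
  exact v.isUnit.mul (hq.mul h1).isUnit_one_sub

theorem GQn.spectrum {q : A} (hq : GQn q) : spectrum ℂ q ⊆ {0} := by
  intro z hz
  by_contra hz0
  have hz0 : z ≠ 0 := hz0
  apply hz
  refine hq.isUnit_sub ?_ (Algebra.commutes z q)
  exact (isUnit_iff_ne_zero.2 hz0).map (algebraMap ℂ A)

theorem gQn_iff {q : A} : GQn q ↔ spectrum ℂ q ⊆ {0} := ⟨GQn.spectrum, GQn.of_spectrum⟩

theorem GQn.of_pow {q : A} (n : ℕ) (h : GQn (q ^ n)) : GQn q := by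
  rw [gQn_iff] at h ⊢
  intro z hz
  have h1 : z ^ n = 0 := h (spectrum.pow_mem_pow q n hz)
  exact eq_zero_of_pow_eq_zero h1

/-- Spectrum contained in `{0} ∪ μ_n`. -/
def Sp (n : ℕ) (a : A) : Prop := ∀ z ∈ spectrum ℂ a, z = 0 ∨ z ^ n = 1

theorem sp_iff {n : ℕ} [Nontrivial A] {a : A} : Sp n a ↔ GQn (a - a ^ (n + 1)) := by
  have h := spectrum.map_polynomial_aeval_of_nonempty (𝕜 := ℂ) a
    (Polynomial.X - Polynomial.X ^ (n + 1)) (spectrum.nonempty a)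
  simp only [map_sub, map_pow, Polynomial.aeval_X, Polynomial.eval_sub, Polynomial.eval_X,
    Polynomial.eval_pow] at h
  rw [gQn_iff, h]
  constructor
  · rintro hs _ ⟨z, hz, rfl⟩
    rcases hs z hz with h0 | h1
    · simp [h0]
    · simp [pow_succ, h1]
  · intro hs z hz
    have h1 : z - z ^ (n + 1) = 0 := hs ⟨z, hz, rfl⟩
    have h2 : z * (1 - z ^ n) = 0 := by rw [← h1]; ring
    rcases mul_eq_zero.1 h2 with h | h
    · exact Or.inl h
    · exact Or.inr (sub_eq_zero.1 h).symm

theorem catalan_le_four_pow (k : ℕ) : catalan k ≤ 4 ^ k := by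
  rw [catalan_eq_centralBinom_div]
  refine (Nat.div_le_self _ _).trans ?_
  rw [Nat.centralBinom_eq_two_mul_choose]
  refine (Nat.choose_le_two_pow _ _).trans ?_
  rw [pow_mul]; norm_num

theorem exists_catalan {u : A} (hu : GQn u) :
    ∃ φ : A, φ = u + φ * φ ∧ GQn φ ∧ ∀ z, Commute z u → Commute z φ := by
  obtain ⟨C, hC, hb⟩ := hu (1 / 8) (by norm_num)
  let f : ℕ → A := fun k => (catalan k : ℂ) • u ^ k
  have hf : Summable fun k => ‖f k‖ := by
    rw [← summable_nat_add_iff 1]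
    refine Summable.of_nonneg_of_le (fun _ => norm_nonneg _) (fun k => ?_)
      (((summable_geometric_of_lt_one (r := (1 / 2 : ℝ)) (by norm_num) (by norm_num)).mul_left C))
    simp only [f, norm_smul, Complex.norm_natCast]
    have h4 : (catalan (k + 1) : ℝ) ≤ 4 ^ (k + 1) := by exact_mod_cast catalan_le_four_pow (k + 1)
    calc (catalan (k + 1) : ℝ) * ‖u ^ (k + 1)‖ ≤ 4 ^ (k + 1) * (C * (1 / 8) ^ (k + 1)) := by
          gcongr; exact hb k
      _ = C * (1 / 2) ^ (k + 1) := by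
          rw [mul_left_comm, ← mul_pow]; norm_num
      _ ≤ C * (1 / 2) ^ k := by
          gcongr C * ?_
          exact pow_le_pow_of_le_one (by norm_num) (by norm_num) (Nat.le_succ k)
  have hcomm : ∀ z, Commute z u → Commute z (∑' k, f k) := fun z hz =>
    Commute.tsum_right z fun k => (hz.pow_right k).smul_right _
  have hc : (∑' k, f k) = 1 + u * ((∑' k, f k) * (∑' k, f k)) := by
    have hs : Summable fun k => ∑ kl ∈ Finset.HasAntidiagonal.antidiagonal k, f kl.1 * f kl.2 :=
      (summable_norm_sum_mul_antidiagonal_of_summable_norm hf hf).of_norm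
    rw [tsum_mul_tsum_eq_tsum_sum_antidiagonal_of_summable_norm hf hf,
      ← hs.tsum_mul_left, hf.of_norm.tsum_eq_zero_add]
    congr 1
    · simp [f]
    · refine tsum_congr fun k => ?_
      simp only [f, catalan_succ']
      rw [Finset.mul_sum]
      push_cast
      rw [Finset.sum_smul]
      refine Finset.sum_congr rfl fun kl hkl => ?_
      rw [Finset.HasAntidiagonal.mem_antidiagonal] at hkl
      rw [smul_mul_smul_comm, mul_smul_comm, ← pow_add, hkl, pow_succ']
  refine ⟨u * ∑' k, f k, ?_, hu.mul (hcomm u (Commute.refl u)), fun z hz =>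
    hz.mul_right (hcomm z hz)⟩
  have h1 : u * (∑' k, f k) = (∑' k, f k) * u := hcomm u (Commute.refl u)
  generalize (∑' k, f k) = c at *
  calc u * c = u * (1 + u * (c * c)) := by rw [← hc]
    _ = u + u * (u * c) * c := by noncomm_ring
    _ = u + u * c * (u * c) := by rw [show u * (u * c) * c = u * (c * u) * c by rw [h1]]; noncomm_ring

/-- Lifting of idempotents modulo quasinilpotents. -/
theorem exists_lift_idem {e : A} (hu : GQn (e - e * e)) :
    ∃ f : A, f * f = f ∧ GQn (e - f) ∧ ∀ z, Commute z e → Commute z f := by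
  obtain ⟨φ, h1, h2, h3⟩ := exists_catalan hu
  have hc : ∀ z, Commute z e → Commute z φ := fun z hz => h3 z (hz.sub_right (hz.mul_right hz))
  have heφ : Commute e φ := hc e (Commute.refl e)
  have hunit : IsUnit (1 - φ * 2) := (h2.mul (Commute.ofNat_right φ 2)).isUnit_one_sub
  obtain ⟨v, hv⟩ := hunit
  have hcv : ∀ z, Commute z e → Commute z (↑v⁻¹ : A) := fun z hz => by
    apply Commute.units_inv_right
    rw [hv]
    exact (Commute.one_right z).sub_right ((hc z hz).mul_right (Commute.ofNat_right z 2))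
  have hev := hcv e (Commute.refl e)
  have hφv : Commute φ (↑v⁻¹ : A) := by
    apply Commute.units_inv_right
    rw [hv]
    exact (Commute.one_right _).sub_right ((Commute.refl φ).mul_right (Commute.ofNat_right _ 2))
  have hvi : (1 - φ * 2) * (↑v⁻¹ : A) = 1 := by rw [← hv]; exact v.mul_inv
  generalize (↑v⁻¹ : A) = w at *
  refine ⟨(e - φ) * w, ?_, ?_, fun z hz => (hz.sub_right (hc z hz)).mul_right (hcv z hz)⟩
  · have k1 : (e - φ) * (1 - e - φ) = 0 := by
      have : (e - φ) * (1 - e - φ) = (e - e * e) + φ * φ - φ + (φ * e - e * φ) := by noncomm_ring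
      rw [this, ← h1, heφ.eq]; simp
    have k2 : (e - φ) * (e - φ) = (e - φ) * (1 - φ * 2) := by
      have : (e - φ) * (1 - φ * 2) - (e - φ) * (e - φ) = (e - φ) * (1 - e - φ) := by noncomm_ring
      rw [k1] at this
      exact (sub_eq_zero.1 this).symm
    have k3 : w * (e - φ) = (e - φ) * w := ((hev.sub_left hφv).eq).symm
    calc (e - φ) * w * ((e - φ) * w) = (e - φ) * (w * (e - φ)) * w := by noncomm_ring
      _ = ((e - φ) * (e - φ)) * w * w := by rw [k3]; noncomm_ring
      _ = (e - φ) * ((1 - φ * 2) * w) * w := by rw [k2]; noncomm_ring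
      _ = (e - φ) * w := by rw [hvi, mul_one]
  · have : e - (e - φ) * w = φ * ((1 - e * 2) * w) := by
      calc e - (e - φ) * w = e * ((1 - φ * 2) * w) - (e - φ) * w := by rw [hvi, mul_one]
        _ = (φ - e * φ * 2) * w := by noncomm_ring
        _ = φ * ((1 - e * 2) * w) := by rw [heφ.eq]; noncomm_ring
    rw [this]
    refine h2.mul (Commute.mul_right ?_ hφv)
    exact (Commute.one_right _).sub_right (heφ.symm.mul_right (Commute.ofNat_right _ 2))

theorem nontriv_of_isQuasinilpotent {q : A} (h : IsQuasinilpotent q) : Nontrivial A := by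
  by_contra hn
  rw [not_nontrivial_iff_subsingleton] at hn
  unfold IsQuasinilpotent at h
  rw [spectrum.of_subsingleton] at h
  exact Set.singleton_ne_empty _ h.symm

theorem isQuasinilpotent_iff [Nontrivial A] {q : A} : IsQuasinilpotent q ↔ GQn q := by
  unfold IsQuasinilpotent
  rw [gQn_iff, Set.subset_singleton_iff_eq]
  constructor
  · exact Or.inr
  · rintro (h | h)
    · exact absurd h (spectrum.nonempty q).ne_empty
    · exact h

theorem idem_spectrum {p : A} (hp : p * p = p) {z : ℂ} (h0 : z ≠ 0) (h1 : z ≠ 1) :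
    IsUnit (algebraMap ℂ A z - p) := by
  have h1' : z - 1 ≠ 0 := sub_ne_zero.2 h1
  have hz : Commute (algebraMap ℂ A z) p := Algebra.commutes z p
  have hu : IsUnit (algebraMap ℂ A (z * (z - 1))) :=
    (isUnit_iff_ne_zero.2 (mul_ne_zero h0 h1')).map (algebraMap ℂ A)
  have : algebraMap ℂ A (z * (z - 1)) =
      (algebraMap ℂ A z - p) * (algebraMap ℂ A z - 1 + p) := by
    rw [map_mul, map_sub, map_one]
    generalize algebraMap ℂ A z = Z at *
    have : (Z - p) * (Z - 1 + p) = Z * (Z - 1) + (Z * p - p * Z) + (p - p * p) := by noncomm_ring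
    rw [this, hp, hz.eq]; simp
  rw [this] at hu
  refine ((Commute.isUnit_mul_iff ?_).1 hu).1
  have e1 : Commute (algebraMap ℂ A z - p) (algebraMap ℂ A z) :=
    (Commute.refl _).sub_left hz.symm
  have e2 : Commute (algebraMap ℂ A z - p) p := hz.sub_left (Commute.refl _)
  exact (e1.sub_right (Commute.one_right _)).add_right e2

/-- data extracted from a Drazin-type inverse -/
theorem drazin_data {n : ℕ} (hn : 1 ≤ n) [Nontrivial A] {a x : A}
    (hx : (∀ z : A, z * a = a * z → x * z = z * x) ∧ x * a * x = x ∧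
      IsQuasinilpotent (a ^ n - a * x)) :
    Sp n a ∧ GQn (a * (1 - a * x)) ∧ Commute a x ∧ (a * x) * (a * x) = a * x := by
  obtain ⟨h1, h2, h3⟩ := hx
  rw [isQuasinilpotent_iff] at h3
  have hc : Commute a x := (h1 a rfl).symm
  have hp : (a * x) * (a * x) = a * x := by
    rw [mul_assoc, ← mul_assoc x a x, h2]
  have hap : Commute a (a * x) := (Commute.refl a).mul_right hc
  refine ⟨?_, ?_, hc, hp⟩
  · intro z hz
    by_contra hcon
    push Not at hcon
    have hz' := spectrum.pow_mem_pow a n hz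
    apply hz'
    have e : algebraMap ℂ A (z ^ n) - a ^ n =
        (algebraMap ℂ A (z ^ n) - a * x) - (a ^ n - a * x) := by abel
    rw [spectrum.mem_resolventSet_iff, e]
    refine h3.isUnit_sub (idem_spectrum hp (pow_ne_zero _ hcon.1) hcon.2) ?_
    refine Commute.sub_left (Algebra.commutes _ _) ?_
    exact (hap.symm.pow_right n).sub_right (Commute.refl _)
  · apply GQn.of_pow n
    have hc1 : Commute a (1 - a * x) := (Commute.one_right a).sub_right hap
    have hid : IsIdempotentElem (1 - a * x) := IsIdempotentElem.one_sub hp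
    rw [hc1.mul_pow, hid.pow_eq (by omega)]
    have : a ^ n * (1 - a * x) = (a ^ n - a * x) * (1 - a * x) := by
      have : (a ^ n - a * x) * (1 - a * x) = a ^ n * (1 - a * x) - (a * x - a * x * (a * x)) := by
        noncomm_ring
      rw [this, hp, sub_self, sub_zero]
    rw [this]
    refine h3.mul (Commute.sub_left (hc1.pow_left n) ?_)
    exact (Commute.one_right _).sub_right (Commute.refl _)

theorem exists_drazin {n : ℕ} (hn : 1 ≤ n) [Nontrivial A] {a : A} (ha : Sp n a) :
    IsGnsDrazinInvertible n a := by
  have hu : GQn (a ^ n - a ^ n * a ^ n) := by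
    have : a ^ n - a ^ n * a ^ n = (a - a ^ (n + 1)) * a ^ (n - 1) := by
      rw [sub_mul, ← pow_succ', ← pow_add, ← pow_add]
      congr 2 <;> omega
    rw [this]
    refine (sp_iff.1 ha).mul ?_
    exact (((Commute.refl a).pow_right _).sub_left ((Commute.refl a).pow_pow _ _))
  obtain ⟨f, hf, hq, hfc⟩ := exists_lift_idem hu
  have hfc' : ∀ z, Commute z a → Commute z f := fun z hz => hfc z (hz.pow_right n)
  have haf := hfc' a (Commute.refl a)
  have hunit : IsUnit (1 - (f - a ^ n)) := by
    refine GQn.isUnit_one_sub ?_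
    have : f - a ^ n = (a ^ n - f) * (-1) := by noncomm_ring
    rw [this]
    exact hq.mul (Commute.neg_one_right _)
  obtain ⟨v, hv⟩ := hunit
  have hcv : ∀ z, Commute z a → Commute z (↑v⁻¹ : A) := fun z hz => by
    apply Commute.units_inv_right
    rw [hv]
    exact (Commute.one_right z).sub_right ((hfc' z hz).sub_right (hz.pow_right n))
  have hvi : (1 - (f - a ^ n)) * (↑v⁻¹ : A) = 1 := by rw [← hv]; exact v.mul_inv
  generalize (↑v⁻¹ : A) = w at *
  have hax : a * (a ^ (n - 1) * (f * w)) = f := by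
    rw [← mul_assoc, ← pow_succ', show n - 1 + 1 = n by omega]
    have : f * (1 - (f - a ^ n)) = f * a ^ n := by
      have : f * (1 - (f - a ^ n)) = f * a ^ n + (f - f * f) := by noncomm_ring
      rw [this, hf]; simp
    rw [← mul_assoc, (haf.pow_left n).eq, ← this, mul_assoc, hvi, mul_one]
  have hcx : ∀ z, Commute z a → Commute z (a ^ (n - 1) * (f * w)) := fun z hz =>
    (hz.pow_right _).mul_right ((hfc' z hz).mul_right (hcv z hz))
  refine ⟨a ^ (n - 1) * (f * w), fun z hz => (hcx z hz).eq.symm, ?_, ?_⟩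
  · rw [mul_assoc, hax, mul_assoc, mul_assoc]
    have hwf : w * f = f * w := (hcv f (haf.symm)).eq.symm
    rw [hwf, ← mul_assoc f f w, hf]
  · rw [hax, isQuasinilpotent_iff]; exact hq

theorem gns_iff {n : ℕ} (hn : 1 ≤ n) [Nontrivial A] {a : A} :
    IsGnsDrazinInvertible n a ↔ Sp n a :=
  ⟨fun ⟨_, hx⟩ => (drazin_data hn hx).1, exists_drazin hn⟩

theorem tri_pow {p T : A} (h : p * T = p * T * p) (k : ℕ) :
    (p * T) ^ (k + 1) = p * T ^ (k + 1) := by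
  induction k with
  | zero => simp
  | succ k ih =>
    rw [pow_succ', ih, ← mul_assoc, ← h, pow_succ' T (k + 1), mul_assoc]

theorem tri_pow' {p T : A} (h : T * p = p * T * p) (k : ℕ) :
    (T * p) ^ (k + 1) = T ^ (k + 1) * p := by
  induction k with
  | zero => simp
  | succ k ih =>
    rw [pow_succ, ih, mul_assoc, ← mul_assoc p T p, ← h, pow_succ T (k + 1), mul_assoc]

theorem tri_Q {p T : A} (h : p * T = p * T * p) (k : ℕ) :
    p * T ^ k = p * T ^ k * p ∨ k = 0 := by
  induction k with
  | zero => simp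
  | succ k ih =>
    left
    rcases ih with ih | rfl
    · rw [pow_succ, ← mul_assoc, ih, mul_assoc (p * T ^ k) p T]
      conv_lhs => rw [h]
      simp only [mul_assoc]
    · simpa using h

theorem tri_Q' {p T : A} (h : T * p = p * T * p) (k : ℕ) :
    T ^ k * p = p * T ^ k * p ∨ k = 0 := by
  induction k with
  | zero => simp
  | succ k ih =>
    left
    rcases ih with ih | rfl
    · rw [pow_succ, mul_assoc, h]
      rw [show T ^ k * (p * T * p) = (T ^ k * p) * (T * p) by noncomm_ring, ih]
      rw [show p * T ^ k * p * (T * p) = p * T ^ k * (p * T * p) by noncomm_ring, ← h]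
      noncomm_ring
    · simpa using h

theorem Sp.left {n : ℕ} [Nontrivial A] {p T : A} (hp : p * p = p)
    (h : p * T = p * T * p) (hT : Sp n T) : Sp n (p * T) := by
  rw [sp_iff] at hT ⊢
  have e : p * T - (p * T) ^ (n + 1) = p * (T - T ^ (n + 1)) := by
    rw [tri_pow h, mul_sub]
  have hQ : p * (T - T ^ (n + 1)) = p * (T - T ^ (n + 1)) * p := by
    rw [mul_sub, sub_mul, ← h, ← (tri_Q h (n + 1)).resolve_right (Nat.succ_ne_zero n)]
  rw [e]
  refine GQn.of_bound 1 (‖p‖ + 1) hT one_pos (by positivity) fun k => ?_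
  rw [tri_pow hQ, one_pow, mul_one]
  exact (norm_mul_le _ _).trans (by gcongr; linarith)

theorem Sp.right {n : ℕ} [Nontrivial A] {p T : A} (hp : p * p = p)
    (h : T * p = p * T * p) (hT : Sp n T) : Sp n (T * p) := by
  rw [sp_iff] at hT ⊢
  have e : T * p - (T * p) ^ (n + 1) = (T - T ^ (n + 1)) * p := by
    rw [tri_pow' h, sub_mul]
  have hQ : (T - T ^ (n + 1)) * p = p * (T - T ^ (n + 1)) * p := by
    rw [mul_sub, sub_mul, sub_mul, ← h,
      ← (tri_Q' h (n + 1)).resolve_right (Nat.succ_ne_zero n)]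
  rw [e]
  refine GQn.of_bound 1 (‖p‖ + 1) hT one_pos (by positivity) fun k => ?_
  rw [tri_pow' hQ, one_pow, mul_one, mul_comm]
  exact (norm_mul_le _ _).trans (by gcongr; linarith)

theorem Sp.glue {n : ℕ} {p T : A} (h : p * T = p * T * p)
    (h1 : Sp n (p * T)) (h2 : Sp n (T * (1 - p))) : Sp n T := by
  intro z hz
  by_contra hcon
  push Not at hcon
  obtain ⟨hz0, hz1⟩ := hcon
  have k1 : z ∉ spectrum ℂ (T * p) := by
    intro hm
    have : z ∈ spectrum ℂ (T * p) \ {0} := ⟨hm, hz0⟩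
    rw [spectrum.nonzero_mul_comm] at this
    rcases h1 z this.1 with h | h
    · exact hz0 h
    · exact hz1 h
  have k2 : z ∉ spectrum ℂ (T * (1 - p)) := by
    intro hm
    rcases h2 z hm with h | h
    · exact hz0 h
    · exact hz1 h
  rw [spectrum.notMem_iff] at k1 k2
  apply hz
  rw [spectrum.mem_resolventSet_iff]
  have hu : IsUnit (algebraMap ℂ A z) := (isUnit_iff_ne_zero.2 hz0).map (algebraMap ℂ A)
  have hm := k1.mul k2
  have hcz : ∀ w : A, algebraMap ℂ A z * w = w * algebraMap ℂ A z := Algebra.commutes z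
  have e : (algebraMap ℂ A z - T * p) * (algebraMap ℂ A z - T * (1 - p)) =
      algebraMap ℂ A z * (algebraMap ℂ A z - T) := by
    generalize algebraMap ℂ A z = Z at *
    have : (Z - T * p) * (Z - T * (1 - p)) = Z * (Z - T) + (Z * (T * p) - (T * p) * Z)
      + T * (p * T - p * T * p) := by noncomm_ring
    rw [this, ← h, hcz (T * p)]; simp
  rw [e] at hm
  exact ((Commute.isUnit_mul_iff (Algebra.commutes z _)).1 hm).2

theorem sp_split {n : ℕ} [Nontrivial A] {p T : A} (hp : p * p = p)
    (h : p * T = p * T * p) : Sp n T ↔ Sp n (p * T) ∧ Sp n (T * (1 - p)) := by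
  refine ⟨fun hT => ⟨hT.left hp h, hT.right (IsIdempotentElem.one_sub hp) ?_⟩,
    fun ⟨h1, h2⟩ => Sp.glue h h1 h2⟩
  have : (1 - p) * T * (1 - p) = T * (1 - p) - (p * T - p * T * p) := by noncomm_ring
  rw [this, ← h]; simp

/-- additive lemma -/
theorem Sp.add {n : ℕ} {a b : A} (h1 : a * (a * b) = a * b * a)
    (h2 : a * b * b = b * (a * b)) (ha : Sp n a) (hb : Sp n b) (hab : GQn (a * b)) :
    Sp n (a + b) := by
  intro z hz
  by_contra hcon
  push Not at hcon
  obtain ⟨hz0, hz1⟩ := hcon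
  have k1 : z ∉ spectrum ℂ a := fun hm => (ha z hm).elim hz0 hz1
  have k2 : z ∉ spectrum ℂ b := fun hm => (hb z hm).elim hz0 hz1
  rw [spectrum.notMem_iff] at k1 k2
  apply hz
  rw [spectrum.mem_resolventSet_iff]
  have hcz : ∀ w : A, algebraMap ℂ A z * w = w * algebraMap ℂ A z := Algebra.commutes z
  have e : (algebraMap ℂ A z - a) * (algebraMap ℂ A z - b) - a * b =
      algebraMap ℂ A z * (algebraMap ℂ A z - (a + b)) := by
    generalize algebraMap ℂ A z = Z at *
    have : (Z - a) * (Z - b) - a * b = Z * (Z - (a + b)) + (Z * a - a * Z) := by noncomm_ring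
    rw [this, hcz a]; simp
  have hm := hab.isUnit_sub (k1.mul k2) (by
    refine Commute.mul_left ?_ ?_
    · exact Commute.sub_left (Algebra.commutes z _) h1
    · exact Commute.sub_left (Algebra.commutes z _) h2.symm)
  rw [e] at hm
  exact ((Commute.isUnit_mul_iff (Algebra.commutes z _)).1 hm).2

theorem ab_pow {a b : A} (h1 : a * (a * b) = a * b * a) (k : ℕ) :
    (a * b) ^ k = a ^ k * b ^ k := by
  have hc : Commute (a * b) a := h1.symm
  induction k with
  | zero => simp
  | succ k ih =>
    rw [pow_succ', ih, ← mul_assoc, (hc.pow_right k).eq, pow_succ a, pow_succ' b]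
    noncomm_ring

theorem GQn.ab_left {a b : A} (h1 : a * (a * b) = a * b * a) (ha : GQn a) : GQn (a * b) := by
  refine GQn.of_bound (‖b‖ + 1) 1 ha (by positivity) one_pos fun k => ?_
  rw [ab_pow h1, one_mul, mul_comm]
  exact (norm_mul_le _ _).trans (by gcongr; exact norm_pow_succ_bd b k)

theorem GQn.ab_right {a b : A} (h1 : a * (a * b) = a * b * a) (hb : GQn b) : GQn (a * b) := by
  refine GQn.of_bound (‖a‖ + 1) 1 hb (by positivity) one_pos fun k => ?_
  rw [ab_pow h1, one_mul]
  exact (norm_mul_le _ _).trans (by gcongr; exact norm_pow_succ_bd a k)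

theorem GQn.sp {n : ℕ} {q : A} (hq : GQn q) : Sp n q := fun _ hz => Or.inl (hq.spectrum hz)

theorem eq_zero_of_bound {q u : A} (hq : GQn q) (M D : ℝ) (hM : 0 < M) (hD : 0 < D)
    (h : ∀ k : ℕ, ‖u‖ ≤ D * M ^ (k + 1) * ‖q ^ (k + 1)‖) : u = 0 := by
  obtain ⟨C, hC, hb⟩ := hq (1 / (2 * M)) (by positivity)
  have ht : Filter.Tendsto (fun k : ℕ => D * C * (1 / 2 : ℝ) ^ (k + 1)) Filter.atTop
      (nhds (D * C * 0)) :=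
    ((tendsto_pow_atTop_nhds_zero_of_lt_one (by norm_num) (by norm_num)).comp
      (Filter.tendsto_add_atTop_nat 1)).const_mul (D * C)
  rw [mul_zero] at ht
  have : ‖u‖ ≤ 0 := by
    refine ge_of_tendsto' ht fun k => (h k).trans ?_
    calc D * M ^ (k + 1) * ‖q ^ (k + 1)‖
        ≤ D * M ^ (k + 1) * (C * (1 / (2 * M)) ^ (k + 1)) := by gcongr; exact hb k
      _ = D * C * (1 / 2) ^ (k + 1) := by
          rw [div_pow, div_pow, mul_pow]; field_simp
  exact norm_le_zero_iff.1 this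

theorem cidem {p T : A} (hp : p * p = p) (h : Commute p T) : p * T = p * T * p := by
  rw [mul_assoc, ← h.eq, ← mul_assoc, hp]

theorem cidem' {p T : A} (hp : p * p = p) (h : Commute p T) : T * p = p * T * p := by
  rw [h.eq, mul_assoc, hp]

theorem comm_rel {u v : A} (h : Commute u v) : u * (u * v) = u * v * u := by
  rw [mul_assoc, h.eq]

theorem comm_rel' {u v : A} (h : Commute u v) : u * v * v = v * (u * v) := by
  rw [h.eq, mul_assoc, h.eq]

theorem mul_mid {p S r : A} (h : S = S * p) : S * r = S * (p * r) := by
  rw [← mul_assoc, ← h]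

theorem side_right {n : ℕ} {a b m : A} (h1 : a * (a * b) = a * b * a)
    (h2 : a * b * b = b * (a * b)) (hm : m * m = m) (hma : Commute m a) (hmab : Commute m (a * b))
    (hmb : m * (b * m) = b * m) (ha : GQn (a * m)) (hb : Sp n (b * m)) :
    Sp n ((a + b) * m) := by
  have e : a * m * (b * m) = a * b * m := by rw [mul_assoc, hmb, mul_assoc]
  have r1 : a * m * (a * m * (b * m)) = a * m * (b * m) * (a * m) := by
    rw [e]
    calc a * m * (a * b * m) = a * (m * (a * b)) * m := by noncomm_ring
      _ = a * (a * b) * (m * m) := by rw [hmab.eq]; noncomm_ring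
      _ = a * b * a * (m * m) := by rw [h1]
      _ = a * b * (a * m) * m := by noncomm_ring
      _ = a * b * (m * a) * m := by rw [hma.eq]
      _ = a * b * m * (a * m) := by noncomm_ring
  rw [add_mul]
  refine Sp.add r1 ?_ ha.sp hb (ha.ab_left r1)
  rw [e]
  calc a * b * m * (b * m) = a * b * (m * (b * m)) := by noncomm_ring
    _ = a * b * b * m := by rw [hmb]; noncomm_ring
    _ = b * ((a * b) * (m * m)) := by rw [h2, hm]; noncomm_ring
    _ = b * ((a * b) * m) * m := by noncomm_ring
    _ = b * (m * (a * b)) * m := by rw [hmab.eq]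
    _ = b * m * (a * b * m) := by noncomm_ring

theorem side_left {n : ℕ} {a b m : A} (h1 : a * (a * b) = a * b * a)
    (h2 : a * b * b = b * (a * b)) (hm : m * m = m) (hmb : Commute m b) (hmab : Commute m (a * b))
    (hma : m * a * m = m * a) (hb : GQn (m * b)) (ha : Sp n (m * a)) :
    Sp n (m * (a + b)) := by
  have e : m * a * (m * b) = m * (a * b) := by rw [← mul_assoc, hma, mul_assoc]
  have r1 : m * a * (m * a * (m * b)) = m * a * (m * b) * (m * a) := by
    rw [e]
    calc m * a * (m * (a * b)) = m * a * m * (a * b) := by noncomm_ring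
      _ = m * (a * (a * b)) := by rw [hma]; noncomm_ring
      _ = m * m * (a * b * a) := by rw [h1, hm]
      _ = m * (m * (a * b)) * a := by noncomm_ring
      _ = m * ((a * b) * m) * a := by rw [hmab.eq]
      _ = m * (a * b) * (m * a) := by noncomm_ring
  rw [mul_add]
  refine Sp.add r1 ?_ ha hb.sp (hb.ab_right r1)
  rw [e]
  calc m * (a * b) * (m * b) = m * ((a * b) * m) * b := by noncomm_ring
    _ = m * m * (a * b * b) := by rw [← hmab.eq]; noncomm_ring
    _ = m * m * b * (a * b) := by rw [h2]; noncomm_ring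
    _ = m * (m * b) * (a * b) := by noncomm_ring
    _ = m * (b * m) * (a * b) := by rw [hmb.eq]
    _ = m * b * (m * (a * b)) := by noncomm_ring

/-- the idempotent of `p * b` is `p * (b * y)` -/
theorem idem_eq {p b y t : A} (hpb : p * b = p * b * p)
    (hby : Commute b y) (hr : b * y * (b * y) = b * y) (hbq : GQn (b * (1 - b * y)))
    (hct : Commute (p * b) t) (hs : p * b * t * (p * b * t) = p * b * t)
    (hcq : GQn (p * b * (1 - p * b * t))) :
    p * (b * y) = p * b * t * p := by
  have hcp : ∀ k : ℕ, (p * b) ^ (k + 1) = p * b ^ (k + 1) := tri_pow hpb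
  have hcp' : ∀ k : ℕ, (p * b) ^ (k + 1) * p = p * b ^ (k + 1) := fun k => by
    rw [hcp, ← (tri_Q hpb (k + 1)).resolve_right (Nat.succ_ne_zero k)]
  have hbr : Commute b (b * y) := (Commute.refl b).mul_right hby
  have hcs : Commute (p * b) (p * b * t) := (Commute.refl _).mul_right hct
  have hridem : IsIdempotentElem (b * y) := hr
  have hsidem : IsIdempotentElem (p * b * t) := hs
  -- first part
  have z1 : p * b * t * p * (1 - b * y) = 0 := by
    refine eq_zero_of_bound hbq (‖t‖ + 1) (‖p‖ + 1) (by positivity) (by positivity) fun k => ?_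
    have e1 : (b * (1 - b * y)) ^ (k + 1) = b ^ (k + 1) * (1 - b * y) := by
      rw [Commute.mul_pow ((Commute.one_right b).sub_right hbr),
        hridem.one_sub.pow_succ_eq]
    have e2 : p * b * t * p * (1 - b * y) =
        t ^ (k + 1) * (p * (b * (1 - b * y)) ^ (k + 1)) := by
      rw [e1, ← mul_assoc p, ← hcp' k]
      conv_lhs => rw [← hsidem.pow_succ_eq k, hct.mul_pow, (hct.pow_pow _ _).eq]
      noncomm_ring
    rw [e2]
    calc _ ≤ ‖t ^ (k + 1)‖ * (‖p‖ * ‖(b * (1 - b * y)) ^ (k + 1)‖) :=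
          (norm_mul_le _ _).trans (by gcongr; exact norm_mul_le _ _)
      _ ≤ (‖t‖ + 1) ^ (k + 1) * ((‖p‖ + 1) * ‖(b * (1 - b * y)) ^ (k + 1)‖) := by
          gcongr
          · exact norm_pow_succ_bd t k
          · linarith
      _ = _ := by ring
  have z2 : (1 - p * b * t) * p * (b * y) = 0 := by
    refine eq_zero_of_bound hcq (‖y‖ + 1) (‖p‖ + 1) (by positivity) (by positivity) fun k => ?_
    have e1 : (p * b * (1 - p * b * t)) ^ (k + 1) = (1 - p * b * t) * (p * b) ^ (k + 1) := by
      have hc1 : Commute (p * b) (1 - p * b * t) := (Commute.one_right _).sub_right hcs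
      rw [hc1.mul_pow, hsidem.one_sub.pow_succ_eq, (hc1.pow_left _).eq]
    have e2 : (1 - p * b * t) * p * (b * y) =
        (p * b * (1 - p * b * t)) ^ (k + 1) * (p * y ^ (k + 1)) := by
      rw [e1]
      conv_lhs => rw [← hridem.pow_succ_eq k, hby.mul_pow]
      rw [show (1 - p * b * t) * (p * b) ^ (k + 1) * (p * y ^ (k + 1)) =
        (1 - p * b * t) * ((p * b) ^ (k + 1) * p) * y ^ (k + 1) by noncomm_ring, hcp' k]
      noncomm_ring
    rw [e2]
    calc _ ≤ ‖(p * b * (1 - p * b * t)) ^ (k + 1)‖ * (‖p‖ * ‖y ^ (k + 1)‖) :=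
          (norm_mul_le _ _).trans (by gcongr; exact norm_mul_le _ _)
      _ ≤ ‖(p * b * (1 - p * b * t)) ^ (k + 1)‖ * ((‖p‖ + 1) * (‖y‖ + 1) ^ (k + 1)) := by
          gcongr
          · linarith
          · exact norm_pow_succ_bd y k
      _ = _ := by ring
  have e : p * (b * y) - p * b * t * p =
    (1 - p * b * t) * p * (b * y) - p * b * t * p * (1 - b * y) := by noncomm_ring
  rw [z1, z2, sub_zero] at e
  exact sub_eq_zero.1 e

theorem isGnsDrazinInvertible_add_tfae (n : ℕ) (hn : 1 ≤ n) (a b x y : A)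
    (hx : (∀ z : A, z * a = a * z → x * z = z * x) ∧ x * a * x = x ∧
      IsQuasinilpotent (a ^ n - a * x))
    (hy : (∀ z : A, z * b = b * z → y * z = z * y) ∧ y * b * y = y ∧
      IsQuasinilpotent (b ^ n - b * y))
    (h1 : a ^ 2 * b = a * b * a) (h2 : a * b ^ 2 = b * a * b)
    (h3 : IsGnsDrazinInvertible n (a * x * b)) :
    [IsGnsDrazinInvertible n (a + b),
     IsGnsDrazinInvertible n (a * x * (a + b) * (b * y)),
     IsGnsDrazinInvertible n (a * x * (a + b)),
     IsGnsDrazinInvertible n ((a + b) * (b * y))].TFAE := by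
  have : Nontrivial A := nontriv_of_isQuasinilpotent hx.2.2
  obtain ⟨ha, haq, hax, hp⟩ := drazin_data hn hx
  obtain ⟨hb, hbq, hby, hr⟩ := drazin_data hn hy
  obtain ⟨t, ht⟩ := h3
  obtain ⟨hc, hcq, hct, hs⟩ := drazin_data hn ht
  have h1 : a * (a * b) = a * b * a := by rw [← h1]; noncomm_ring
  have h2 : a * b * b = b * (a * b) := by rw [← mul_assoc b a b, ← h2]; noncomm_ring
  have hxab : Commute x (a * b) := hx.1 (a * b) h1.symm
  have hyab : Commute y (a * b) := hy.1 (a * b) h2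
  have hpab : Commute (a * x) (a * b) := Commute.mul_left h1 hxab
  have hrab : Commute (b * y) (a * b) := Commute.mul_left h2.symm hyab
  have hpa : Commute (a * x) a := (Commute.refl a).mul_left hax.symm
  have hrb : Commute (b * y) b := (Commute.refl b).mul_left hby.symm
  have hxp : x * (a * x) = x := by rw [← mul_assoc]; exact hx.2.1
  have hry : b * y * y = y := by rw [hby.eq]; exact hy.2.1
  have hpb0 : a * x * b = a * b * x := by rw [hax.eq, mul_assoc, hxab.eq]
  have hpb : a * x * b = a * x * b * (a * x) := by
    rw [hpb0, mul_assoc (a * b), hxp]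
  have har0 : a * (b * y) = y * (a * b) := by rw [hyab.eq, mul_assoc]
  have har : b * y * (a * (b * y)) = a * (b * y) := by
    rw [har0, ← mul_assoc, hry]
  -- `c = p b` commutes with `a`
  have hca : a * (a * x * b) = a * x * b * a := by
    rw [hpb0]
    calc a * (a * b * x) = a * (a * b) * x := by noncomm_ring
      _ = a * b * (a * x) := by rw [h1]; noncomm_ring
      _ = a * b * x * a := by rw [hax.eq]; noncomm_ring
  have hta : Commute t a := ht.1 a hca
  have hcx : Commute (a * x * b) x := (hx.1 _ hca.symm).symm
  have htx : Commute t x := ht.1 x hcx.symm.eq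
  set p := a * x with hpdef
  set r := b * y with hrdef
  have hprs : p * r = p * b * t * p := idem_eq hpb hby hr hbq hct hs hcq
  have hpT : p * (a + b) = p * (a + b) * p := by
    rw [mul_add, add_mul, ← hpb, ← cidem hp hpa]
  have i13 : Sp n (a + b) ↔ Sp n (p * (a + b)) := by
    rw [sp_split hp hpT]
    refine and_iff_left (side_right h1 h2 (IsIdempotentElem.one_sub hp)
      ((Commute.one_left _).sub_left hpa) ((Commute.one_left _).sub_left hpab) ?_ haq
      ((sp_split hp hpb).1 hb).2)
    have : (1 - p) * (b * (1 - p)) = b * (1 - p) - (p * b - p * b * p) := by noncomm_ring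
    rw [this, ← hpb]; simp
  have hr' : (1 - r) * (1 - r) = 1 - r := IsIdempotentElem.one_sub hr
  have hra : (1 - r) * a = (1 - r) * a * (1 - r) := by
    have : (1 - r) * a * (1 - r) = (1 - r) * a - (a * r - r * (a * r)) := by noncomm_ring
    rw [this, har]; simp
  have hrT : (1 - r) * (a + b) = (1 - r) * (a + b) * (1 - r) := by
    have hc' : Commute (1 - r) b := (Commute.one_left _).sub_left hrb
    rw [mul_add, add_mul, ← hra, ← cidem hr' hc']
  have i14 : Sp n (a + b) ↔ Sp n ((a + b) * r) := by
    rw [sp_split hr' hrT, sub_sub_cancel]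
    refine and_iff_right (side_left h1 h2 hr' ((Commute.one_left _).sub_left hrb)
      ((Commute.one_left _).sub_left hrab) hra.symm ?_ ((sp_split hr' hra).1 ha).1)
    have hc' : Commute (1 - r) b := (Commute.one_left _).sub_left hrb
    rw [hc'.eq]; exact hbq
  have hca' : Commute a (p * b) := hca
  have hcp : Commute (p * b) p := Commute.mul_right hca'.symm hcx
  have htp : Commute t p := Commute.mul_right hta htx
  have hsp : Commute (p * b * t) p := hcp.mul_left htp
  have hsa : Commute (p * b * t) a := hca'.symm.mul_left hta
  have hsc : Commute (p * b * t) (p * b) := (Commute.refl _).mul_left hct.symm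
  have hT : p * (a + b) = p * a + p * b := mul_add _ _ _
  have hsT : Commute (p * b * t) (p * (a + b)) := by
    rw [hT]; exact (hsp.mul_right hsa).add_right hsc
  have i32 : Sp n (p * (a + b)) ↔ Sp n (p * (a + b) * r) := by
    have e : p * (a + b) * r = p * b * t * (p * (a + b)) := by
      calc p * (a + b) * r = p * (a + b) * (p * r) := mul_mid hpT
        _ = p * (a + b) * (p * b * t) * p := by rw [hprs]; noncomm_ring
        _ = p * b * t * (p * (a + b) * p) := by rw [← hsT.eq]; noncomm_ring
        _ = _ := by rw [← hpT]
    have hst : p * b * t * (p * (a + b)) = p * b * t * (p * (a + b)) * (p * b * t) :=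
      cidem hs hsT
    rw [sp_split hs hst, ← e]
    refine and_iff_left ?_
    rw [hT, add_mul]
    have hs1a : Commute (1 - p * b * t) a := (Commute.one_left _).sub_left hsa
    have hs1p : Commute (1 - p * b * t) p := (Commute.one_left _).sub_left hsp
    have hs1c : Commute (1 - p * b * t) (p * b) := (Commute.one_left _).sub_left hsc
    have hpac : Commute (p * a) (p * b) := hcp.symm.mul_left hca'
    have hs1pa : Commute (1 - p * b * t) (p * a) := hs1p.mul_right hs1a
    have hs1' : (1 - p * b * t) * (1 - p * b * t) = 1 - p * b * t := IsIdempotentElem.one_sub hs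
    have hpasp : Sp n (p * a) := ha.left hp (cidem hp hpa)
    have hall : Commute (p * a * (1 - p * b * t)) (p * b * (1 - p * b * t)) :=
      Commute.mul_left (hpac.mul_right hs1pa.symm) (hs1c.mul_right (Commute.refl _))
    have hr1 : p * a * (1 - p * b * t) * (p * a * (1 - p * b * t) * (p * b * (1 - p * b * t))) =
      p * a * (1 - p * b * t) * (p * b * (1 - p * b * t)) * (p * a * (1 - p * b * t)) := comm_rel hall
    refine Sp.add hr1 ?_ ?_ hcq.sp (hcq.ab_right hr1)
    · exact comm_rel' hall
    · exact hpasp.right hs1' (cidem' hs1' hs1pa)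
  simp only [gns_iff hn]
  tfae_have 1 ↔ 3 := i13
  tfae_have 1 ↔ 4 := i14
  tfae_have 3 ↔ 2 := i32
  tfae_finish
end

section
/- Let 𝒜 be a complex unital Banach algebra and let a, b ∈ √J(𝒜) satisfy a b² = b a b and a² b = a b a. Then a + b ∈ √J(𝒜) and a − b ∈ √J(𝒜). -/
/-- In any ring, `1 + x y` is a unit for all `y` iff `x` lies in the Jacobson radical. -/
theorem sqrtJ_mem_iff {R : Type*} [Ring R] (x : R) :
    (∀ y : R, IsUnit (1 + x * y)) ↔ x ∈ Ideal.jacobson (⊥ : Ideal R) := by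
  constructor
  · intro h
    rw [Ideal.mem_jacobson_iff]
    intro y
    obtain ⟨u, hu⟩ := h y
    have hw : (↑u⁻¹ : R) * (1 + x * y) = 1 := by rw [← hu]; exact u.inv_mul
    refine ⟨1 - y * (↑u⁻¹ : R) * x, ?_⟩
    rw [Ideal.mem_bot]
    have e : (1 - y * (↑u⁻¹ : R) * x) * y * x + (1 - y * (↑u⁻¹ : R) * x) - 1
        = y * x - y * ((↑u⁻¹ : R) * (1 + x * y)) * x := by noncomm_ring
    rw [e, hw]; simp
  · intro h y
    have hr : x * y ∈ Ideal.jacobson (⊥ : Ideal R) := Ideal.mul_mem_right y _ h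
    obtain ⟨s, hs⟩ := Ideal.exists_mul_add_sub_mem_of_mem_jacobson _ hr
    rw [Ideal.mem_bot, sub_eq_zero] at hs
    have hs1 : s - 1 ∈ Ideal.jacobson (⊥ : Ideal R) := by
      have : s - 1 = -s * (x * y) := by
        rw [← hs]; noncomm_ring
      rw [this]
      exact Ideal.mul_mem_left _ _ hr
    obtain ⟨t, ht⟩ := Ideal.exists_mul_sub_mem_of_sub_one_mem_jacobson _ hs1
    rw [Ideal.mem_bot, sub_eq_zero] at ht
    have htr : t = x * y + 1 := left_inv_eq_right_inv ht hs
    rw [htr] at ht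
    rw [add_comm]
    exact ⟨⟨x * y + 1, s, ht, hs⟩, rfl⟩

/-- The purely algebraic statement for nilpotent elements. -/
theorem sqrtJ_nilp {R : Type*} [Ring R] (a b : R) (ha : IsNilpotent a) (hb : IsNilpotent b)
    (h1 : a * b ^ 2 = b * a * b) (h2 : a ^ 2 * b = a * b * a) : IsNilpotent (a + b) := by
  obtain ⟨p, hp⟩ := ha
  obtain ⟨q, hq⟩ := hb
  obtain ⟨c, hc⟩ : ∃ c, c = a * b := ⟨_, rfl⟩
  obtain ⟨s, hs⟩ : ∃ s, s = a + b := ⟨_, rfl⟩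
  have hca : Commute c a := by
    change c * a = a * c
    rw [hc, ← h2, pow_two, mul_assoc]
  have hcb : Commute c b := by
    change c * b = b * c
    rw [hc, mul_assoc, ← pow_two, h1, mul_assoc]
  have hcs : Commute c s := by rw [hs]; exact hca.add_right hcb
  -- powers of `c`
  have hcpow : ∀ n : ℕ, c ^ n = a ^ n * b ^ n := by
    intro n
    induction n with
    | zero => simp
    | succ n ih =>
      rw [pow_succ, ih, mul_assoc, ← (hcb.pow_right n).eq, hc, pow_succ a, pow_succ' b]
      simp only [mul_assoc]
  have hcp : c ^ p = 0 := by rw [hcpow, hp, zero_mul]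
  have step1 : ∀ n : ℕ, ∃ t, Commute c t ∧ a * s ^ n = a ^ (n + 1) + c * t := by
    intro n
    induction n with
    | zero => exact ⟨0, Commute.zero_right c, by simp⟩
    | succ n ih =>
      obtain ⟨t, ht, e⟩ := ih
      refine ⟨a ^ n + t * s, (hca.pow_right n).add_right (ht.mul_right hcs), ?_⟩
      have e2 : a ^ (n + 1) * b = c * a ^ n := by
        rw [(hca.pow_right n).eq, hc, pow_succ, mul_assoc]
      have e3 : a ^ (n + 1) * s = a ^ (n + 1 + 1) + c * a ^ n := by
        rw [← e2, hs, mul_add, ← pow_succ]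
      rw [pow_succ, ← mul_assoc, e, add_mul, e3, mul_add, mul_assoc, add_assoc]
  obtain ⟨t0, ht0, e0⟩ := step1 p
  rw [pow_succ, hp, zero_mul, zero_add] at e0
  have step2 : ∀ j : ℕ, ∃ t, Commute c t ∧ s ^ (p + j) = b ^ j * s ^ p + c * t := by
    intro j
    induction j with
    | zero => exact ⟨0, Commute.zero_right c, by simp⟩
    | succ j ih =>
      obtain ⟨t, ht, e⟩ := ih
      refine ⟨b ^ j * t0 + t * s,
        ((hcb.pow_right j).mul_right ht0).add_right (ht.mul_right hcs), ?_⟩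
      have e4 : s ^ p * s = c * t0 + b * s ^ p := by
        rw [← pow_succ, pow_succ', ← e0, ← add_mul, ← hs]
      rw [← add_assoc, pow_succ, e, add_mul, mul_assoc, e4, mul_add, ← mul_assoc (b ^ j) c,
        ← (hcb.pow_right j).eq, pow_succ, mul_add]
      simp only [mul_assoc]
      abel
  obtain ⟨t, ht, e⟩ := step2 q
  rw [hq, zero_mul, zero_add] at e
  refine ⟨(p + q) * p, ?_⟩
  rw [← hs, pow_mul, e, ht.mul_pow, hcp, zero_mul]

theorem sqrtJ_iff_nilp {R : Type*} [Ring R] (x : R) :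
    (∃ k : ℕ, 1 ≤ k ∧ ∀ y : R, IsUnit (1 + x ^ k * y)) ↔
      IsNilpotent (Ideal.Quotient.mk (Ideal.jacobson (⊥ : Ideal R)) x) := by
  simp only [sqrtJ_mem_iff]
  constructor
  · rintro ⟨k, -, hk⟩
    exact ⟨k, by rw [← map_pow]; exact Ideal.Quotient.eq_zero_iff_mem.2 hk⟩
  · rintro ⟨k, hk⟩
    refine ⟨k + 1, Nat.le_add_left 1 k, ?_⟩
    rw [← map_pow] at hk
    rw [pow_succ']
    exact Ideal.mul_mem_left _ _ (Ideal.Quotient.eq_zero_iff_mem.1 hk)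

variable {A : Type*} [NormedRing A] [NormedAlgebra ℂ A] [CompleteSpace A]

/-- Membership in the Jacobson radical `J(𝒜) = {a : 1 + a y is invertible for all y}`. -/
def InJacobsonRadical (a : A) : Prop := ∀ y : A, IsUnit (1 + a * y)

/-- Membership in `√J(𝒜) = {a : a ^ k ∈ J(𝒜) for some k ≥ 1}`. -/
def InSqrtJacobsonRadical (a : A) : Prop := ∃ k : ℕ, 1 ≤ k ∧ InJacobsonRadical (a ^ k)

/-- `a` is pseudo `n`-strong Drazin invertible (pns-Drazin invertible): there is `x`
commuting with every element commuting with `a`, with `x * a * x = x` and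
`(a ^ n - a * x) ^ k ∈ J(𝒜)` for some `k ≥ 1`. -/
def IsPnsDrazinInvertible (n : ℕ) (a : A) : Prop :=
  ∃ x : A, (∀ y : A, y * a = a * y → x * y = y * x) ∧ x * a * x = x ∧
    ∃ k : ℕ, 1 ≤ k ∧ InJacobsonRadical ((a ^ n - a * x) ^ k)

theorem sqrtJacobson_add_sub (a b : A)
    (ha : InSqrtJacobsonRadical a) (hb : InSqrtJacobsonRadical b)
    (h1 : a * b ^ 2 = b * a * b) (h2 : a ^ 2 * b = a * b * a) :
    InSqrtJacobsonRadical (a + b) ∧ InSqrtJacobsonRadical (a - b) := by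
  have ha' := (sqrtJ_iff_nilp a).1 ha
  have hb' := (sqrtJ_iff_nilp b).1 hb
  have h1' := congrArg (Ideal.Quotient.mk (Ideal.jacobson (⊥ : Ideal A))) h1
  have h2' := congrArg (Ideal.Quotient.mk (Ideal.jacobson (⊥ : Ideal A))) h2
  simp only [map_mul, map_pow] at h1' h2'
  constructor
  · refine (sqrtJ_iff_nilp (a + b)).2 ?_
    rw [map_add]
    exact sqrtJ_nilp _ _ ha' hb' h1' h2'
  · refine (sqrtJ_iff_nilp (a - b)).2 ?_
    rw [map_sub, sub_eq_add_neg]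
    refine sqrtJ_nilp _ _ ha' hb'.neg ?_ ?_
    · simpa using h1'
    · simpa using h2'
end

section
/- Let 𝒜 be a complex unital Banach algebra, let n ≥ 1 be an integer, and let a ∈ 𝒜. Then a is pns-Drazin invertible if and only if a − a^{n+1} ∈ √J(𝒜). -/
variable {A : Type*} [NormedRing A] [NormedAlgebra ℂ A] [CompleteSpace A]

set_option linter.unusedSectionVars false

open Filter Topology

theorem InJacobsonRadical.mul_right' {a : A} (h : InJacobsonRadical a) (z : A) :
    InJacobsonRadical (a * z) := by
  intro y
  rw [mul_assoc]
  exact h _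

theorem isUnit_one_add_mul_swap {a b : A} (h : IsUnit (1 + a * b)) : IsUnit (1 + b * a) := by
  obtain ⟨u, hu⟩ := h
  have h1 : (1 + a * b) * (↑u⁻¹ : A) = 1 := by rw [← hu]; exact u.mul_inv
  have h2 : (↑u⁻¹ : A) * (1 + a * b) = 1 := by rw [← hu]; exact u.inv_mul
  generalize (↑u⁻¹ : A) = v at h1 h2
  refine ⟨⟨1 + b * a, 1 - b * v * a, ?_, ?_⟩, rfl⟩
  · calc (1 + b * a) * (1 - b * v * a) = 1 + b * a - b * ((1 + a * b) * v) * a := by noncomm_ring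
      _ = 1 := by rw [h1]; noncomm_ring
  · calc (1 - b * v * a) * (1 + b * a) = 1 + b * a - b * (v * (1 + a * b)) * a := by noncomm_ring
      _ = 1 := by rw [h2]; noncomm_ring

theorem InJacobsonRadical.mul_left' {a : A} (h : InJacobsonRadical a) (z : A) :
    InJacobsonRadical (z * a) := by
  intro y
  have := isUnit_one_add_mul_swap (a := a * y) (b := z) (by rw [mul_assoc]; exact h _)
  rwa [← mul_assoc] at this

theorem InJacobsonRadical.add' {a b : A} (ha : InJacobsonRadical a) (hb : InJacobsonRadical b) :
    InJacobsonRadical (a + b) := by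
  intro y
  obtain ⟨u, hu⟩ := ha y
  have h1 := (hb.mul_left' (↑u⁻¹ : A)) y
  have : 1 + (a + b) * y = u * (1 + (↑u⁻¹ : A) * b * y) := by
    rw [mul_add, mul_one, mul_assoc, Units.mul_inv_cancel_left, hu]
    noncomm_ring
  rw [this]
  exact u.isUnit.mul h1

theorem inSqrt_isUnit_one_add {z : A} (h : InSqrtJacobsonRadical z) : IsUnit (1 + z) := by
  obtain ⟨k, -, hk⟩ := h
  have h1 : IsUnit (1 - (-z) ^ k) := by
    have := hk (-(-1) ^ k)
    rw [neg_pow, (Commute.neg_one_left z).pow_pow k k |>.eq]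
    simpa [sub_eq_add_neg] using this
  rw [← mul_neg_geom_sum] at h1
  have hc : Commute (1 - -z) (∑ i ∈ Finset.range k, (-z) ^ i) := by
    rw [Commute, SemiconjBy, mul_neg_geom_sum, geom_sum_mul_neg]
  have := (hc.isUnit_mul_iff.1 h1).1
  simpa using this

theorem inSqrt_spectralRadius {z : A} (h : InSqrtJacobsonRadical z) :
    spectralRadius ℂ z = 0 := by
  rw [spectralRadius, ← bot_eq_zero, iSup₂_eq_bot]
  intro l hl
  by_cases h0 : l = 0
  · simp [h0]
  · exfalso
    apply hl
    obtain ⟨k, hk1, hk⟩ := h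
    have h2 : IsUnit (1 + (-l⁻¹) • z) := by
      apply inSqrt_isUnit_one_add
      refine ⟨k, hk1, ?_⟩
      rw [smul_pow, ← mul_one (z ^ k), ← mul_smul_comm]
      exact hk.mul_right' _
    have h3 : algebraMap ℂ A l - z = algebraMap ℂ A l * (1 + (-l⁻¹) • z) := by
      rw [Algebra.algebraMap_eq_smul_one, smul_one_mul, smul_add, smul_smul]
      simp [h0, sub_eq_add_neg]
    show IsUnit _
    rw [h3]
    exact ((IsUnit.mk0 l h0).map (algebraMap ℂ A)).mul h2

theorem inSqrt_summable {z : A} (h : InSqrtJacobsonRadical z) :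
    Summable fun m : ℕ => ‖(catalan m : A) * z ^ m‖ := by
  have h1 := spectrum.pow_norm_pow_one_div_tendsto_nhds_spectralRadius z
  rw [inSqrt_spectralRadius h] at h1
  have h2 : ∀ᶠ m : ℕ in atTop, ENNReal.ofReal (‖z ^ m‖ ^ (1 / m : ℝ)) < ENNReal.ofReal (1 / 8) :=
    h1.eventually_lt_const (by simp)
  have h3 : ∀ᶠ m : ℕ in atTop, ‖‖(catalan m : A) * z ^ m‖‖ ≤ (1 / 2 : ℝ) ^ m := by
    filter_upwards [h2, eventually_gt_atTop 0] with m hm hm0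
    rw [ENNReal.ofReal_lt_ofReal_iff (by norm_num)] at hm
    have hz : ‖z ^ m‖ ≤ (1 / 8) ^ m := by
      have := pow_le_pow_left₀ (by positivity) hm.le m
      rwa [one_div (m : ℝ), Real.rpow_inv_natCast_pow (norm_nonneg _) hm0.ne'] at this
    have hc : (catalan m : ℝ) ≤ 4 ^ m := by
      have a1 := succ_mul_catalan_eq_centralBinom m
      have a2 := Nat.centralBinom_le_four_pow m
      have : catalan m ≤ 4 ^ m := by nlinarith [Nat.zero_le (m * catalan m)]
      exact_mod_cast this
    rw [norm_norm, ← nsmul_eq_mul]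
    calc ‖catalan m • z ^ m‖ ≤ catalan m * ‖z ^ m‖ := by
          exact norm_nsmul_le
      _ ≤ 4 ^ m * (1 / 8) ^ m := by gcongr
      _ = (1 / 2) ^ m := by rw [← mul_pow]; norm_num
  exact Summable.of_norm_bounded_eventually_nat (summable_geometric_of_lt_one (by norm_num)
    (by norm_num)) h3

theorem catalan_tsum {z : A} (h : InSqrtJacobsonRadical z) :
    (∑' m : ℕ, (catalan m : A) * z ^ m) =
      1 + z * ((∑' m : ℕ, (catalan m : A) * z ^ m) * (∑' m : ℕ, (catalan m : A) * z ^ m)) := by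
  have hs := inSqrt_summable h
  rw [tsum_mul_tsum_eq_tsum_sum_antidiagonal_of_summable_norm hs hs]
  rw [hs.of_norm.tsum_eq_zero_add]
  have hs2 := (summable_norm_sum_mul_antidiagonal_of_summable_norm hs hs).of_norm
  rw [← hs2.tsum_mul_left]
  congr 1
  · simp
  · congr 1
    ext m
    rw [catalan_succ', Nat.cast_sum, Finset.sum_mul, Finset.mul_sum]
    refine Finset.sum_congr rfl fun ij hij => ?_
    rw [Finset.HasAntidiagonal.mem_antidiagonal] at hij
    rw [← hij, pow_succ', pow_add, Nat.cast_mul]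
    simp only [← nsmul_eq_mul, smul_mul_assoc, mul_smul_comm, smul_smul]
    rw [mul_comm (catalan ij.1)]

/-- The double commutant. -/
abbrev dcomm (a : A) : Subalgebra ℂ A := Subalgebra.centralizer ℂ (Set.centralizer {a})

theorem mem_dcomm {a x : A} : x ∈ dcomm a ↔ ∀ y : A, y * a = a * y → x * y = y * x := by
  rw [Subalgebra.mem_centralizer_iff]
  simp only [Set.mem_centralizer_iff, Set.mem_singleton_iff, forall_eq]
  exact ⟨fun h y hy => (h y hy.symm).symm, fun h y hy => (h y hy.symm).symm⟩

theorem self_mem_dcomm (a : A) : a ∈ dcomm a := mem_dcomm.2 fun _ h => h.symm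

noncomputable instance dcommCommRing (a : A) : CommRing (dcomm a) :=
  { (inferInstance : Ring (dcomm a)) with
    mul_comm := fun x y => Subtype.ext
      (mem_dcomm.1 x.2 y.1 (mem_dcomm.1 y.2 a rfl)) }

theorem dcomm_isUnit {a : A} (x : dcomm a) (h : IsUnit (x : A)) : ∃ v : dcomm a, x * v = 1 := by
  obtain ⟨u, hu⟩ := h
  refine ⟨⟨(↑u⁻¹ : A), mem_dcomm.2 fun y hy => ?_⟩, Subtype.ext ?_⟩
  · have h1 : Commute (u : A) y := by rw [hu]; exact mem_dcomm.1 x.2 y hy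
    exact h1.units_inv_left
  · show (x : A) * (↑u⁻¹ : A) = 1
    rw [← hu]; exact u.mul_inv

/-- The trace of the Jacobson radical on the double commutant. -/
def radIdeal (a : A) : Ideal (dcomm a) where
  carrier := {x | InJacobsonRadical (x : A)}
  add_mem' := fun hx hy => hx.add' hy
  zero_mem' := fun y => by simp
  smul_mem' := fun c _ hx => hx.mul_left' (c : A)

theorem mem_radical_radIdeal {a : A} (x : dcomm a) :
    x ∈ (radIdeal a).radical ↔ InSqrtJacobsonRadical (x : A) := by
  constructor
  · rintro ⟨k, hk⟩
    refine ⟨k + 1, by omega, ?_⟩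
    rw [pow_succ]
    exact InJacobsonRadical.mul_right' hk _
  · rintro ⟨k, -, hk⟩
    exact ⟨k, hk⟩

theorem exists_root {a : A} (g : dcomm a) (hg : g ∈ (radIdeal a).radical) :
    ∃ c : dcomm a, c = 1 + g * (c * c) := by
  rw [mem_radical_radIdeal] at hg
  have hcl : IsClosed ((dcomm a : Subalgebra ℂ A) : Set A) := Set.isClosed_centralizer _
  have hmem : (∑' m : ℕ, (catalan m : A) * (g : A) ^ m) ∈ dcomm a := by
    refine hcl.mem_of_tendsto (inSqrt_summable hg).of_norm.hasSum (Eventually.of_forall fun s => ?_)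
    exact sum_mem fun i _ => mul_mem (natCast_mem _ _) (pow_mem g.2 _)
  exact ⟨⟨_, hmem⟩, Subtype.ext (catalan_tsum hg)⟩

theorem isPnsDrazinInvertible_iff (n : ℕ) (hn : 1 ≤ n) (a : A) :
    IsPnsDrazinInvertible n a ↔ InSqrtJacobsonRadical (a - a ^ (n + 1)) := by
  have key := mem_radical_radIdeal (a := a)
  let b : dcomm a := ⟨a, self_mem_dcomm a⟩
  constructor
  · rintro ⟨x, hx, hxax, hw⟩
    let y : dcomm a := ⟨x, mem_dcomm.2 hx⟩
    have hy : y * b * y = y := Subtype.ext hxax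
    have hw' : b ^ n - b * y ∈ (radIdeal a).radical := (key _).2 hw
    refine (key (b - b ^ (n + 1))).1 ?_
    have h1 : b * (1 - b * y) ∈ (radIdeal a).radical := by
      apply (radIdeal a).radical_isRadical
      refine ⟨n, ?_⟩
      have hid : IsIdempotentElem (1 - b * y) := by
        rw [IsIdempotentElem]
        linear_combination b * hy
      rw [mul_pow, hid.pow_eq (by omega)]
      have := Ideal.mul_mem_right (1 - b * y) _ hw'
      convert this using 1
      linear_combination - b * hy
    have h2 := sub_mem h1 (Ideal.mul_mem_left _ b hw')
    convert h2 using 1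
    ring
  · intro h
    have hb : b - b ^ (n + 1) ∈ (radIdeal a).radical := (key _).2 h
    obtain ⟨n, rfl⟩ := Nat.exists_eq_add_of_le' hn
    have hg := Ideal.mul_mem_left _ (b ^ n) hb
    have hgf : b ^ n * (b - b ^ (n + 1 + 1)) = b ^ (n + 1) - b ^ (n + 1) * b ^ (n + 1) := by ring
    rw [hgf] at hg
    have hf : b ^ (n + 1) = b * b ^ n := by ring
    obtain ⟨c, hc⟩ := exists_root _ hg
    generalize hF : b ^ (n + 1) = f at *
    have hh : (f - f * f) * c ∈ (radIdeal a).radical := Ideal.mul_mem_right _ _ hg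
    have hhq : (f - f * f) * c - ((f - f * f) * c) * ((f - f * f) * c) = f - f * f := by
      linear_combination (f - f * f) * hc
    generalize (f - f * f) * c = h at hh hhq
    obtain ⟨u, hu⟩ := dcomm_isUnit (1 + (-2) * h)
      (inSqrt_isUnit_one_add ((key _).1 (Ideal.mul_mem_left _ (-2) hh)))
    obtain ⟨e, he⟩ : ∃ e, e = (f - h) * u := ⟨_, rfl⟩
    have he1 : e * (1 - 2 * h) = f - h := by
      rw [he]; linear_combination (f - h) * hu
    have hee : e * e = e := by
      have : (f - h) * (f - h) = (f - h) * (1 + (-2) * h) := by linear_combination hhq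
      rw [he]
      linear_combination u * u * this + (f - h) * u * hu
    have hfe : f - e ∈ (radIdeal a).radical := by
      have := Ideal.mul_mem_right (1 - 2 * e) _ hh
      convert this using 1
      linear_combination - he1
    obtain ⟨v, hv⟩ := dcomm_isUnit (1 + (f - e)) (inSqrt_isUnit_one_add ((key _).1 hfe))
    have hbx : b * (b ^ n * e * v) = e := by
      linear_combination (-e * v) * hf + e * hv + v * hee
    have hx2 : (b ^ n * e * v) * b * (b ^ n * e * v) = b ^ n * e * v := by
      linear_combination (b ^ n * e * v) * hbx + b ^ n * v * hee
    have hfin : b ^ (n + 1) - b * (b ^ n * e * v) ∈ (radIdeal a).radical := by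
      rw [hF, hbx]; exact hfe
    exact ⟨((b ^ n * e * v : dcomm a) : A), mem_dcomm.1 (b ^ n * e * v).2,
      congrArg Subtype.val hx2, (key _).1 hfin⟩
end

section
/- Let 𝒜 be a complex unital Banach algebra and let n ≥ 1 be an integer. If a ∈ 𝒜 is pns-Drazin invertible (with parameter n), then a is pns-Drazin invertible with parameter 2n. -/
variable {A : Type*} [NormedRing A] [NormedAlgebra ℂ A] [CompleteSpace A]

theorem isPnsDrazinInvertible_two_mul (n : ℕ) (hn : 1 ≤ n) (a : A)
    (h : IsPnsDrazinInvertible n a) :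
    IsPnsDrazinInvertible (2 * n) a := by
  obtain ⟨x, hc, hx, k, hk, hJ⟩ := h
  refine ⟨x, hc, hx, k, hk, ?_⟩
  have hax : Commute a x := (hc a rfl).symm
  have hidem : (a * x) * (a * x) = a * x := by
    rw [mul_assoc, ← mul_assoc x a x, hx]
  have hcomm : Commute (a ^ n) (a * x) :=
    ((Commute.refl a).mul_right hax).pow_left n
  have hfac : a ^ (2 * n) - a * x = (a ^ n - a * x) * (a ^ n + a * x) := by
    rw [sub_mul, mul_add, mul_add, hidem, hcomm.eq, two_mul, pow_add]
    abel
  have hcomm2 : Commute (a ^ n - a * x) (a ^ n + a * x) :=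
    ((Commute.refl _).add_right hcomm).sub_left (hcomm.symm.add_right (Commute.refl _))
  rw [hfac, hcomm2.mul_pow]
  intro y
  rw [mul_assoc]
  exact hJ _
end

section
/- Let 𝒜 be a complex unital Banach algebra, let n ≥ 1 be an integer, and let a, b ∈ 𝒜 both be pns-Drazin invertible. If a b = 0, then a + b is pns-Drazin invertible. -/
variable {A : Type*} [NormedRing A] [NormedAlgebra ℂ A] [CompleteSpace A]

theorem aux_nil_add {R : Type*} [Ring R] (n : ℕ) (a b : R) (hab : a * b = 0)
    (ha : IsNilpotent (a ^ (n + 1) - a)) (hb : IsNilpotent (b ^ (n + 1) - b)) :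
    IsNilpotent ((a + b) ^ (n + 1) - (a + b)) := by
  set c := a + b with hc
  have h1 : ∀ m : ℕ, a * c ^ m = a * a ^ m := by
    intro m
    induction m with
    | zero => simp
    | succ m ih =>
      rw [pow_succ, ← mul_assoc, ih, mul_assoc, hc, mul_add, ← pow_succ, mul_add]
      have : a * (a ^ m * b) = 0 := by
        rw [← mul_assoc, ← pow_succ', pow_succ, mul_assoc, hab, mul_zero]
      rw [this, add_zero]
  have h2 : ∀ m : ℕ, c ^ m * b = b ^ m * b := by
    intro m
    induction m with
    | zero => simp
    | succ m ih =>
      rw [pow_succ', mul_assoc, ih, hc, add_mul, ← pow_succ, pow_succ' b m, ← mul_assoc a, hab,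
        zero_mul, zero_add, mul_assoc, ← pow_succ, ← pow_succ']
  have h3 : ∀ k : ℕ, a * (c ^ (n + 1) - c) ^ k = a * (a ^ (n + 1) - a) ^ k := by
    intro k
    induction k with
    | zero => simp
    | succ k ih =>
      have e1 : a * (c ^ (n + 1) - c) = a * (a ^ (n + 1) - a) := by
        have := h1 1
        rw [pow_one, pow_one] at this
        rw [mul_sub, mul_sub, h1, this]
      have e2 : a * (a ^ (n + 1) - a) = (a ^ (n + 1) - a) * a := by
        rw [mul_sub, sub_mul, ← pow_succ, ← pow_succ']
      rw [pow_succ', ← mul_assoc, e1, e2, mul_assoc, ih, ← mul_assoc, ← e2, mul_assoc, ← pow_succ']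
  have h4 : ∀ k : ℕ, (c ^ (n + 1) - c) ^ k * b = (b ^ (n + 1) - b) ^ k * b := by
    intro k
    induction k with
    | zero => simp
    | succ k ih =>
      have e1 : (c ^ (n + 1) - c) * b = (b ^ (n + 1) - b) * b := by
        have := h2 1
        rw [pow_one, pow_one] at this
        rw [sub_mul, sub_mul, h2, this]
      have e2 : b * (b ^ (n + 1) - b) = (b ^ (n + 1) - b) * b := by
        rw [mul_sub, sub_mul, ← pow_succ, ← pow_succ']
      rw [pow_succ, mul_assoc, e1, ← e2, ← mul_assoc, ih, mul_assoc, e2, ← mul_assoc, ← pow_succ]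
  obtain ⟨k, hk⟩ := ha
  obtain ⟨l, hl⟩ := hb
  have hcc : Commute (c ^ (n + 1) - c) c :=
    ((Commute.refl c).pow_left _).sub_left (Commute.refl c)
  have h5 : (c ^ (n + 1) - c) ^ l * c * (c ^ (n + 1) - c) ^ k = 0 := by
    conv_lhs => rw [hc]
    rw [mul_add, add_mul, ← hc, mul_assoc, h3, hk, h4, hl]
    simp
  have h6 : (c ^ (n + 1) - c) ^ (l + k) * c = 0 := by
    rw [pow_add, mul_assoc, (hcc.pow_left k).eq, ← mul_assoc, h5]
  refine ⟨l + k + 1, ?_⟩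
  have h7 : c ^ (n + 1) - c = c * (c ^ n - 1) := by rw [mul_sub, mul_one, pow_succ']
  rw [pow_succ]
  nth_rewrite 2 [h7]
  rw [← mul_assoc, h6, zero_mul]

theorem aux_nil_of {R : Type*} [Ring R] (n : ℕ) (a x : R) (hx : Commute a x)
    (hxax : x * a * x = x) (h : IsNilpotent (a ^ n - a * x)) :
    IsNilpotent (a ^ (n + 1) - a) := by
  have he : (a * x) * (a * x) = a * x := by
    rw [mul_assoc, ← mul_assoc x, hxax]
  have hae : Commute a (a * x) := (Commute.refl a).mul_right hx
  have haw : Commute a (a ^ n - a * x) := ((Commute.refl a).pow_right n).sub_right hae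
  have hew : Commute (a * x) (a ^ n - a * x) := (hae.symm.pow_right n).sub_right (Commute.refl _)
  have ha1 : Commute a (1 - a * x) := (Commute.one_right a).sub_right hae
  have hidem : IsIdempotentElem (1 - a * x) := IsIdempotentElem.one_sub he
  have h1 : IsNilpotent (a * (1 - a * x)) := by
    have h2 : IsNilpotent ((a ^ n - a * x) * (1 - a * x)) :=
      Commute.isNilpotent_mul_right ((Commute.one_right _).sub_right hew.symm) h
    obtain ⟨k, hk⟩ := h2
    refine ⟨(n + 1) * k, ?_⟩
    rw [pow_mul, ha1.mul_pow, hidem.pow_succ_eq]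
    have : a ^ (n + 1) * (1 - a * x) = a * ((a ^ n - a * x) * (1 - a * x)) := by
      rw [sub_mul, mul_sub (a * x) 1, he, mul_one, sub_self, sub_zero, pow_succ', mul_assoc]
    rw [this, (haw.mul_right ha1).mul_pow, hk, mul_zero]
  have h3 : a ^ (n + 1) - a = a * (a ^ n - a * x) - a * (1 - a * x) := by
    rw [pow_succ']; noncomm_ring
  rw [h3]
  have hc1 : Commute (a ^ n - a * x) (1 - a * x) := (Commute.one_right _).sub_right hew.symm
  refine Commute.isNilpotent_sub ?_ (Commute.isNilpotent_mul_left haw h) h1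
  exact ((Commute.refl a).mul_right ha1).mul_left (haw.symm.mul_right hc1)

theorem aux_mem_iff (a : A) : InJacobsonRadical a ↔ a ∈ Ring.jacobson A := by
  have key : a ∈ Ring.jacobson A ↔ ∀ y : A, ∃ z : A, z * (1 + y * a) = 1 := by
    rw [← Ideal.jacobson_bot, Ideal.mem_jacobson_iff]
    refine forall_congr' fun y => exists_congr fun z => ?_
    rw [Ideal.mem_bot, sub_eq_zero, mul_add, mul_one, mul_assoc, add_comm]
  constructor
  · intro h
    rw [key]
    intro y
    have h1 : IsUnit (1 + y * a) := by
      obtain ⟨u, hu⟩ := h y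
      have hl : (↑u⁻¹ : A) * (1 + a * y) = 1 := by rw [← hu]; simp
      have hr : (1 + a * y) * (↑u⁻¹ : A) = 1 := by rw [← hu]; simp
      set v : A := ↑u⁻¹
      refine isUnit_iff_exists.mpr ⟨1 - y * v * a, ?_, ?_⟩
      · have : (1 + y * a) * (1 - y * v * a) = 1 + y * a - y * ((1 + a * y) * v) * a := by
          noncomm_ring
        rw [this, hr]; noncomm_ring
      · have : (1 - y * v * a) * (1 + y * a) = 1 + y * a - y * (v * (1 + a * y)) * a := by
          noncomm_ring
        rw [this, hl]; noncomm_ring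
    obtain ⟨u, hu⟩ := h1
    exact ⟨↑u⁻¹, by rw [← hu]; simp⟩
  · intro h y
    have hay : a * y ∈ Ring.jacobson A := Ideal.mul_mem_right _ _ h
    have key2 : ∀ b ∈ Ring.jacobson A, ∃ z : A, z * (1 + b) = 1 := by
      intro b hb
      rw [← Ideal.jacobson_bot, Ideal.mem_jacobson_iff] at hb
      obtain ⟨z, hz⟩ := hb 1
      refine ⟨z, ?_⟩
      rw [Ideal.mem_bot, sub_eq_zero] at hz
      rw [mul_one] at hz
      rw [mul_add, mul_one, add_comm, hz]
    obtain ⟨z, hz⟩ := key2 _ hay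
    have hz' : z = 1 + -(z * (a * y)) := by rw [← hz]; noncomm_ring
    obtain ⟨w, hw⟩ := key2 (-(z * (a * y))) (neg_mem (Ideal.mul_mem_left _ _ hay))
    rw [← hz'] at hw
    have : w = 1 + a * y := by
      calc w = w * (z * (1 + a * y)) := by rw [hz, mul_one]
        _ = 1 + a * y := by rw [← mul_assoc, hw, one_mul]
    exact isUnit_iff_exists.mpr ⟨z, by rw [← this, hw], hz⟩

theorem aux_sqrt_iff (a : A) : (∃ k : ℕ, 1 ≤ k ∧ InJacobsonRadical (a ^ k)) ↔
    IsNilpotent (Ideal.Quotient.mk (Ring.jacobson A) a) := by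
  constructor
  · rintro ⟨k, -, h⟩
    refine ⟨k, ?_⟩
    rw [← map_pow, Ideal.Quotient.eq_zero_iff_mem]
    exact (aux_mem_iff _).1 h
  · rintro ⟨k, h⟩
    refine ⟨k + 1, by omega, (aux_mem_iff _).2 ?_⟩
    rw [← Ideal.Quotient.eq_zero_iff_mem, map_pow, pow_succ, h, zero_mul]

theorem aux_unit (v : A) (h : IsUnit (Ideal.Quotient.mk (Ring.jacobson A) v)) : IsUnit v := by
  obtain ⟨w', h1, h2⟩ := isUnit_iff_exists.1 h
  obtain ⟨w, rfl⟩ := Ideal.Quotient.mk_surjective w'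
  have key : ∀ z : A, Ideal.Quotient.mk (Ring.jacobson A) z = 1 → IsUnit z := by
    intro z hz
    rw [← map_one (Ideal.Quotient.mk (Ring.jacobson A)), Ideal.Quotient.eq] at hz
    have := (aux_mem_iff _).2 hz 1
    simpa using this
  obtain ⟨u1, hu1⟩ := key (v * w) (by rw [map_mul, h1])
  obtain ⟨u2, hu2⟩ := key (w * v) (by rw [map_mul, h2])
  have hr : v * (w * ↑u1⁻¹) = 1 := by rw [← mul_assoc, ← hu1]; simp
  have hl : (↑u2⁻¹ * w) * v = 1 := by rw [mul_assoc, ← hu2]; simp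
  have : ↑u2⁻¹ * w = w * ↑u1⁻¹ := left_inv_eq_right_inv hl hr
  exact isUnit_iff_exists.mpr ⟨w * ↑u1⁻¹, hr, by rw [← this, hl]⟩

theorem aux_bound (w : A) (h : IsNilpotent (Ideal.Quotient.mk (Ring.jacobson A) w)) :
    ∀ᶠ m : ℕ in Filter.atTop, ‖w ^ m‖ ≤ (1 / 8 : ℝ) ^ m := by
  have hs : spectralRadius ℂ w = 0 := by
    rw [spectralRadius]
    refine le_antisymm (iSup₂_le fun z hz => ?_) bot_le
    by_contra hne
    have hz0 : z ≠ 0 := by rintro rfl; simp at hne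
    apply hz
    rw [spectrum.mem_resolventSet_iff]
    apply aux_unit
    rw [map_sub]
    have hu : IsUnit (Ideal.Quotient.mk (Ring.jacobson A) (algebraMap ℂ A z)) :=
      ((IsUnit.mk0 z hz0).map (algebraMap ℂ A)).map _
    have hc : Commute (Ideal.Quotient.mk (Ring.jacobson A) (algebraMap ℂ A z))
      (Ideal.Quotient.mk (Ring.jacobson A) w) := Commute.map (show Commute (algebraMap ℂ A z) w from Algebra.commutes z w) _
    rw [sub_eq_add_neg]
    exact IsNilpotent.isUnit_add_left_of_commute h.neg hu hc.symm.neg_left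
  have ht := spectrum.pow_nnnorm_pow_one_div_tendsto_nhds_spectralRadius w
  rw [hs] at ht
  have hev := ht.eventually (gt_mem_nhds (show (0 : ENNReal) < ((1 / 8 : NNReal) : ENNReal) by
    rw [ENNReal.coe_pos]; norm_num))
  filter_upwards [hev, Filter.eventually_gt_atTop 0] with m hm hm0
  rw [← ENNReal.coe_rpow_of_nonneg _ (by positivity), ENNReal.coe_lt_coe] at hm
  have h1 : ‖w ^ m‖₊ ≤ (1 / 8 : NNReal) ^ m := by
    have h2 := pow_le_pow_left₀ zero_le hm.le m
    rwa [← NNReal.rpow_natCast, ← NNReal.rpow_mul, one_div_mul_cancel (by positivity),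
      NNReal.rpow_one] at h2
  have := NNReal.coe_le_coe.2 h1
  simpa using this

theorem aux_catalan (w : A) (h : IsNilpotent (Ideal.Quotient.mk (Ring.jacobson A) w)) :
    ∃ f : A, f = 1 + w * (f * f) ∧ ∀ y : A, Commute y w → Commute y f := by
  have hcat : ∀ m : ℕ, (catalan m : ℝ) ≤ 4 ^ m := by
    intro m
    have : catalan m ≤ 4 ^ m := by
      rw [catalan_eq_centralBinom_div]
      refine (Nat.div_le_self _ _).trans ?_
      rw [Nat.centralBinom]
      refine (Nat.choose_le_two_pow _ _).trans ?_
      rw [pow_mul]; norm_num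
    exact_mod_cast this
  have hsum : Summable fun m : ℕ => ‖(catalan m : A) * w ^ m‖ := by
    refine Summable.of_norm_bounded_eventually_nat
      (g := fun m => (‖(1 : A)‖) * (1 / 2 : ℝ) ^ m) ?_ ?_
    · exact (summable_geometric_of_lt_one (by norm_num) (by norm_num)).mul_left _
    · filter_upwards [aux_bound w h] with m hm
      rw [norm_norm]
      have hn : ‖(catalan m : A)‖ ≤ catalan m * ‖(1 : A)‖ := Nat.norm_cast_le _
      calc ‖(catalan m : A) * w ^ m‖ ≤ ‖(catalan m : A)‖ * ‖w ^ m‖ := norm_mul_le _ _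
        _ ≤ (4 ^ m * ‖(1 : A)‖) * (1 / 8) ^ m := by
            gcongr
            exact hn.trans (by gcongr; exact hcat m)
        _ = ‖(1 : A)‖ * (1 / 2 : ℝ) ^ m := by
            rw [mul_comm (4 ^ m : ℝ), mul_assoc, ← mul_pow]; norm_num
  have hs := hsum.of_norm
  refine ⟨∑' m : ℕ, (catalan m : A) * w ^ m, ?_, ?_⟩
  · rw [tsum_mul_tsum_eq_tsum_sum_antidiagonal_of_summable_norm hsum hsum]
    have hterm : ∀ m : ℕ, ∑ kl ∈ Finset.HasAntidiagonal.antidiagonal m,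
        ((catalan kl.1 : A) * w ^ kl.1) * ((catalan kl.2 : A) * w ^ kl.2)
        = (catalan (m + 1) : A) * w ^ m := by
      intro m
      rw [catalan_succ', Nat.cast_sum, Finset.sum_mul]
      refine Finset.sum_congr rfl fun kl hkl => ?_
      rw [Finset.HasAntidiagonal.mem_antidiagonal] at hkl
      rw [← hkl, pow_add, Nat.cast_mul, mul_assoc, mul_assoc, ← mul_assoc (w ^ kl.1),
        ← (Nat.cast_commute (catalan kl.2) (w ^ kl.1)).eq, mul_assoc]
    simp_rw [hterm]
    have hsq : Summable fun m : ℕ => (catalan (m + 1) : A) * w ^ m := by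
      have := (summable_norm_sum_mul_antidiagonal_of_summable_norm hsum hsum).of_norm
      simp_rw [hterm] at this
      exact this
    rw [hs.tsum_eq_zero_add, ← hsq.tsum_mul_left]
    congr 1
    · simp
    · refine tsum_congr fun m => ?_
      rw [pow_succ', ← mul_assoc, ← mul_assoc, (Nat.cast_commute (catalan (m + 1)) w).eq]
  · intro y hy
    show _ * _ = _ * _
    rw [← hs.tsum_mul_left, ← hs.tsum_mul_right]
    refine tsum_congr fun m => ?_
    exact ((Nat.cast_commute (catalan m) y).symm.mul_right (hy.pow_right m)).eq

theorem aux_inv_commute (y g : A) (v : Aˣ) (hv : ↑v = g) (h : Commute y g) :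
    Commute y (↑v⁻¹ : A) := by
  subst hv
  exact h.units_inv_right

theorem aux_lift (p : A) (h : IsNilpotent (Ideal.Quotient.mk (Ring.jacobson A) (p * p - p))) :
    ∃ e : A, e * e = e ∧ IsNilpotent (Ideal.Quotient.mk (Ring.jacobson A) (p - e)) ∧
      ∀ y : A, Commute y p → Commute y e := by
  set π := Ideal.Quotient.mk (Ring.jacobson A)
  set u := p * p - p with hu
  have hyu : ∀ y : A, Commute y p → Commute y u := fun y hy =>
    (hy.mul_right hy).sub_right hy
  have hy4 : ∀ y : A, Commute y p → Commute y (1 + 4 * u) := fun y hy =>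
    (Commute.one_right y).add_right ((Nat.cast_commute 4 y).symm.mul_right (hyu y hy))
  have h4u : IsUnit (1 + 4 * u) := by
    apply aux_unit
    rw [map_add, map_one]
    refine IsNilpotent.isUnit_one_add ?_
    rw [map_mul]
    exact Commute.isNilpotent_mul_left (((Nat.cast_commute 4 u : Commute (4 : A) u)).map π) h
  obtain ⟨v, hv⟩ := h4u
  have hyv : ∀ y : A, Commute y p → Commute y (↑v⁻¹ : A) := fun y hy =>
    aux_inv_commute y _ v hv (hy4 y hy)
  have hpp := Commute.refl p
  have hup : Commute p u := hyu p hpp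
  have huv : Commute u (↑v⁻¹ : A) := hyv u hup.symm
  set w := u * (↑v⁻¹ : A) with hw
  have hwn : IsNilpotent (π w) := by
    rw [hw, map_mul]
    exact Commute.isNilpotent_mul_right (huv.map π) h
  have hyw : ∀ y : A, Commute y p → Commute y w := fun y hy => (hyu y hy).mul_right (hyv y hy)
  obtain ⟨f, hf, hyf⟩ := aux_catalan w hwn
  have hwf : Commute w f := hyf w (Commute.refl w)
  set t := w * f with ht
  have hyt : ∀ y : A, Commute y p → Commute y t := fun y hy =>
    (hyw y hy).mul_right (hyf y (hyw y hy))
  have htt : t = w + t * t := by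
    calc t = w * (1 + w * (f * f)) := by rw [← hf]
      _ = w + w * (w * f) * f := by noncomm_ring
      _ = w + t * t := by rw [hwf.eq, ht]; simp only [mul_assoc]
  have htn : IsNilpotent (π t) := by
    rw [ht, map_mul]
    exact Commute.isNilpotent_mul_right (hwf.map π) hwn
  have hpt : Commute p t := hyt p hpp
  have hvw : (1 + 4 * u) * w = u := by
    rw [hw, huv.eq, ← mul_assoc, ← hv]; simp
  refine ⟨p + (1 - 2 * p) * t, ?_, ?_, ?_⟩
  · have e1 : (p + (1 - 2 * p) * t) * (p + (1 - 2 * p) * t) =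
        (p + (1 - 2 * p) * t) + (u - (1 + 4 * u) * (t - t * t)) := by
      have hpt' : t * p = p * t := hpt.eq.symm
      have hpt2 : ∀ z, t * (p * z) = p * (t * z) := fun z => by
        rw [← mul_assoc, hpt', mul_assoc]
      rw [hu]
      simp only [mul_add, add_mul, mul_sub, sub_mul, mul_one, one_mul, mul_assoc, two_mul,
        hpt', hpt2, (show (4 : A) = 1 + 1 + 1 + 1 by norm_num)]
      abel
    have e2 : t - t * t = w := by
      nth_rewrite 1 [htt]; abel
    rw [e1, e2, hvw, sub_self, add_zero]
  · have hc : Commute (1 - 2 * p) t :=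
      (Commute.one_left t).sub_left ((Nat.cast_commute 2 t).mul_left hpt)
    have : p - (p + (1 - 2 * p) * t) = -((1 - 2 * p) * t) := by abel
    rw [this, map_neg, map_mul]
    exact (Commute.isNilpotent_mul_left (hc.map π) htn).neg
  · intro y hy
    exact hy.add_right (((Commute.one_right y).sub_right
      ((Nat.cast_commute 2 y).symm.mul_right hy)).mul_right (hyt y hy))

theorem aux_converse (n : ℕ) (hn : 1 ≤ n) (c : A)
    (h : IsNilpotent (Ideal.Quotient.mk (Ring.jacobson A) (c ^ (n + 1) - c))) :
    IsPnsDrazinInvertible n c := by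
  obtain ⟨m, rfl⟩ : ∃ m, n = m + 1 := ⟨n - 1, by omega⟩
  set π := Ideal.Quotient.mk (Ring.jacobson A)
  have hp : IsNilpotent (π (c ^ (m + 1) * c ^ (m + 1) - c ^ (m + 1))) := by
    have : c ^ (m + 1) * c ^ (m + 1) - c ^ (m + 1) = c ^ m * (c ^ (m + 1 + 1) - c) := by
      rw [mul_sub, ← pow_add, ← pow_add, ← pow_succ]
      congr 2; omega
    rw [this, map_mul]
    refine Commute.isNilpotent_mul_left (Commute.map ?_ π) h
    exact (((Commute.refl c).pow_left m).pow_right _).sub_right ((Commute.refl c).pow_left m)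
  obtain ⟨e, he, hne, hye⟩ := aux_lift _ hp
  have hye' : ∀ y : A, Commute y c → Commute y e := fun y hy => hye y (hy.pow_right _)
  have hg : IsUnit (1 + (c ^ (m + 1) - e)) := by
    apply aux_unit
    rw [map_add, map_one]
    exact IsNilpotent.isUnit_one_add hne
  obtain ⟨v, hv⟩ := hg
  have hyv : ∀ y : A, Commute y c → Commute y (↑v⁻¹ : A) := fun y hy =>
    aux_inv_commute y _ v hv
      ((Commute.one_right y).add_right ((hy.pow_right _).sub_right (hye' y hy)))
  have hce : Commute c e := hye' c (Commute.refl c)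
  have hcv : Commute c (↑v⁻¹ : A) := hyv c (Commute.refl c)
  have hge : (v : A) * e = c ^ (m + 1) * e := by
    rw [hv, add_mul, sub_mul, he, one_mul]; abel
  have hcx : c * (c ^ m * (↑v⁻¹ * e)) = e := by
    rw [← mul_assoc, ← pow_succ', ← mul_assoc, (hcv.pow_left (m + 1)).eq, mul_assoc, ← hge]
    simp
  have hyx : ∀ y : A, Commute y c → Commute y (c ^ m * (↑v⁻¹ * e)) := fun y hy =>
    (hy.pow_right m).mul_right ((hyv y hy).mul_right (hye' y hy))
  refine ⟨c ^ m * (↑v⁻¹ * e), ?_, ?_, ?_⟩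
  · intro y hy
    exact (hyx y hy).eq.symm
  · rw [mul_assoc, hcx, mul_assoc, mul_assoc, he]
  · rw [hcx]
    exact (aux_sqrt_iff _).2 hne

theorem aux_forward (n : ℕ) (a : A) (h : IsPnsDrazinInvertible n a) :
    IsNilpotent (Ideal.Quotient.mk (Ring.jacobson A) a ^ (n + 1) -
      Ideal.Quotient.mk (Ring.jacobson A) a) := by
  obtain ⟨x, h1, h2, h3⟩ := h
  have h4 := (aux_sqrt_iff _).1 h3
  have hc : Commute a x := (h1 a rfl).symm
  refine aux_nil_of n _ (Ideal.Quotient.mk (Ring.jacobson A) x) (hc.map _) ?_ ?_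
  · rw [← map_mul, ← map_mul, h2]
  · simpa using h4

theorem isPnsDrazinInvertible_add_of_mul_eq_zero (n : ℕ) (hn : 1 ≤ n) (a b : A)
    (ha : IsPnsDrazinInvertible n a) (hb : IsPnsDrazinInvertible n b)
    (hab : a * b = 0) :
    IsPnsDrazinInvertible n (a + b) := by
  apply aux_converse n hn
  have := aux_nil_add n _ _ (by rw [← map_mul, hab, map_zero]) (aux_forward n a ha)
    (aux_forward n b hb)
  simpa using this
end

section
/- Let 𝒜 be a complex unital Banach algebra, let n ≥ 1 be an integer, and let a, w ∈ 𝒜 with w ≠ 0. Then a w is gns-Drazin invertible if and only if w a is gns-Drazin invertible. -/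
variable {A : Type*} [NormedRing A] [NormedAlgebra ℂ A] [CompleteSpace A]

theorem IsQuasinilpotent.mul_swap [Nontrivial A] (p q : A) (h : IsQuasinilpotent (p * q)) :
    IsQuasinilpotent (q * p) := by
  unfold IsQuasinilpotent at *
  have h1 := spectrum.nonzero_mul_comm (𝕜 := ℂ) p q
  rw [h, Set.sdiff_self] at h1
  have hne : (spectrum ℂ (q * p)).Nonempty := spectrum.nonempty _
  exact (Set.Nonempty.subset_singleton_iff hne).1 (Set.sdiff_eq_empty.1 h1.symm)

theorem IsGnsDrazinInvertible.mul_swap (n : ℕ) (hn : 1 ≤ n) (a w : A) [Nontrivial A]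
    (h : IsGnsDrazinInvertible n (a * w)) : IsGnsDrazinInvertible n (w * a) := by
  obtain ⟨x, hc, hx, hq⟩ := h
  have hb : x * (a * w) = a * w * x := hc _ rfl
  have h2 : x * x * (a * w) = x := by rw [mul_assoc, hb, ← mul_assoc, hx]
  have h3 : a * w * (x * x) = x := by rw [← mul_assoc, ← hb, hx]
  refine ⟨w * (x * x) * a, ?_, ?_, ?_⟩
  · intro z hz
    have hd : x * (a * z * w) = a * z * w * x := by
      apply hc
      calc a * z * w * (a * w) = a * (z * (w * a)) * w := by noncomm_ring
        _ = a * w * (a * z * w) := by rw [hz]; noncomm_ring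
    have hcd : Commute x (a * z * w) := hd
    have hd3 : x * x * x * (a * z * w) = a * z * w * (x * x * x) :=
      ((hcd.mul_left hcd).mul_left hcd).eq
    calc w * (x * x) * a * z = w * (x * (x * x * (a * w))) * a * z := by rw [h2]
      _ = w * (x * x * x) * a * (w * a * z) := by noncomm_ring
      _ = w * (x * x * (x * (a * z * w))) * a := by rw [← hz]; noncomm_ring
      _ = w * (a * z * w * (x * x * x)) * a := by rw [← mul_assoc (x * x), hd3]
      _ = (w * a * z) * w * x * x * x * a := by noncomm_ring
      _ = z * w * (a * w * (x * x)) * x * a := by rw [← hz]; noncomm_ring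
      _ = z * (w * (x * x) * a) := by rw [h3]; noncomm_ring
  · calc w * (x * x) * a * (w * a) * (w * (x * x) * a)
        = w * (x * x * (a * w)) * (a * w * (x * x)) * a := by noncomm_ring
      _ = w * (x * x) * a := by rw [h2, h3]; noncomm_ring
  · obtain ⟨m, rfl⟩ : ∃ m, n = m + 1 := ⟨n - 1, by omega⟩
    have hp : ∀ k : ℕ, (w * a) ^ (k + 1) = w * (a * w) ^ k * a := by
      intro k
      induction k with
      | zero => simp
      | succ k ih => rw [pow_succ, ih, pow_succ (a * w)]; simp only [mul_assoc]
    have e : (w * a) ^ (m + 1) - w * a * (w * (x * x) * a)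
        = w * (((a * w) ^ m - x) * a) := by
      have e1 : w * a * (w * (x * x) * a) = w * (a * w * (x * x)) * a := by noncomm_ring
      rw [hp, e1, h3]
      simp only [sub_mul, mul_sub, mul_assoc]
    rw [e]
    apply IsQuasinilpotent.mul_swap
    rw [mul_assoc, sub_mul, ← pow_succ, hb]
    exact hq

theorem isGnsDrazinInvertible_mul_comm (n : ℕ) (hn : 1 ≤ n) (a w : A) (hw : w ≠ 0) :
    IsGnsDrazinInvertible n (a * w) ↔ IsGnsDrazinInvertible n (w * a) := by
  haveI : Nontrivial A := ⟨⟨w, 0, hw⟩⟩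
  exact ⟨IsGnsDrazinInvertible.mul_swap n hn a w, IsGnsDrazinInvertible.mul_swap n hn w a⟩
end
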